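/- arXiv:1608.01390 — 3 statements merged into one kernel-verified Lean document; each statement's English description precedes it below -/
import Mathlib

section
/- Let N be a positive integer and let Γ₀(N) = {γ ∈ M₂(ℤ) : det γ = ±1 and the lower-left entry of γ is divisible by N}, a subgroup of GL₂(ℚ) acting on the projective line ℙ¹(ℚ) by fractional linear transformations. Then the number of orbits of Γ₀(N) on ℙ¹(ℚ) equals ∑_{d ∣ N} φ_u(gcd(d, N/d)). -/
noncomputable section

/-- The reduced totient function `φᵤ(n) = #((ℤ/nℤ)ˣ / {±1})`. -/
def phiU (n : ℕ) : ℕ := Nat.card ((ZMod n)ˣ ⧸ Subgroup.zpowers (-1 : (ZMod n)ˣ))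

/-- Two points of `ℙ¹(ℚ)` are related if some `γ ∈ Γ₀(N)` (an integer matrix of
determinant `±1` whose lower-left entry is divisible by `N`) carries one to the other
by fractional linear transformation. -/
def gamma0Rel (N : ℕ) (x y : Projectivization ℚ (Fin 2 → ℚ)) : Prop :=
  ∃ γ : Matrix (Fin 2) (Fin 2) ℤ,
    (γ.det = 1 ∨ γ.det = -1) ∧ (N : ℤ) ∣ γ 1 0 ∧
    ∃ (v : Fin 2 → ℚ) (hv : v ≠ 0)
      (hw : (γ.map ((↑) : ℤ → ℚ)).mulVec v ≠ 0),
      x = Projectivization.mk ℚ v hv ∧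
      y = Projectivization.mk ℚ ((γ.map ((↑) : ℤ → ℚ)).mulVec v) hw

theorem exists_gamma0_matrix_of_dvd_sub {d e a c a' c' : ℤ} (hac : IsCoprime a (d * c))
    (hce : IsCoprime c e) (hac' : IsCoprime a' (d * c')) (hce' : IsCoprime c' e)
    (h : (Int.gcd d e : ℤ) ∣ a' * c' - a * c) :
    ∃ p q r s : ℤ, p * s - q * (d * e * r) = 1 ∧ p * a + q * (d * c) = a' ∧
      d * e * r * a + s * (d * c) = d * c' := by
  obtain ⟨E, b, hE⟩ := hac
  obtain ⟨E', b', hE'⟩ := hac'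
  obtain ⟨w, z, hwz⟩ := hce.mul_left hce'
  have hmd : (Int.gcd d e : ℤ) ∣ d := Int.gcd_dvd_left ..
  have hm : (Int.gcd d e : ℤ) ∣ c' * E - c * E' := by
    have h1 : c' * E - c * E' = E * E' * (a' * c' - a * c) +
        d * (E * c' * (b' * c') - E' * c * (b * c)) := by
      linear_combination (-c' * E) * hE' + c * E' * hE
    rw [h1]
    exact dvd_add (h.mul_left _) (hmd.mul_right _)
  obtain ⟨t, ht⟩ := hm
  rw [Int.gcd_eq_gcd_ab] at ht
  set x := Int.gcdA d e
  set y := Int.gcdB d e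
  have hj : c' * E - c * E' = d * c * c' * (x * t * w) + e * (d * x * t * z + y * t) := by
    linear_combination ht - d * x * t * hwz
  generalize x * t * w = k at hj
  generalize d * x * t * z + y * t = j at hj
  refine ⟨a' * E - (a' * k - b') * (d * c), a' * b + (a' * k - b') * a, j,
    d * c' * b + (d * c' * k + E') * a, ?_, ?_, ?_⟩
  · have : d * e * j = d * c' * E - (d * c' * k + E') * (d * c) := by
      linear_combination -d * hj
    rw [this]
    linear_combination hE' + (a' * E' + b' * (d * c')) * hE
  · linear_combination a' * hE
  · linear_combination (-d * a) * hj + d * c' * hE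

theorem gamma0_matrix_invariant {d e d' e' a c a' c' p q r s : ℤ} {ε : ℤˣ}
    (hd : 0 < d) (hd' : 0 < d') (hN : d * e = d' * e')
    (hce : IsCoprime c e) (hce' : IsCoprime c' e')
    (hdet : IsUnit (p * s - q * (d * e * r))) (ha : a' = ε * (p * a + q * (d * c)))
    (hc : d' * c' = ε * (d * e * r * a + s * (d * c))) :
    d = d' ∧ (Int.gcd d e : ℤ) ∣ a' * c' - (p * s - q * (d * e * r)) * (a * c) := by
  have hε : (ε : ℤ) * ε = 1 := by
    rcases Int.units_eq_one_or ε with rfl | rfl <;> simp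
  have h1 : d ∣ d' := by
    obtain ⟨x, y, hxy⟩ := hce'
    refine ⟨x * ε * (e * r * a + s * c) + y * e, ?_⟩
    linear_combination (-d') * hxy + x * hc - y * hN
  have h2 : d' ∣ d := by
    have h3 : d' ∣ d * c := by
      refine (hdet.dvd_mul_left).1 ⟨p * ε * c' - ε * (e' * r * a'), ?_⟩
      linear_combination (-p * ε) * hc + ε * (d' * e' * r) * ha
        + (-p * (d * e * r * a + s * (d * c)) + (d' * e' * r) * (p * a + q * (d * c))) * hε
        - r * p * a * hN - r * q * d * c * hN
    obtain ⟨x, y, hxy⟩ := hce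
    obtain ⟨k, hk⟩ := h3
    exact ⟨x * k + y * e', by linear_combination (-d) * hxy + x * hk + y * hN⟩
  obtain rfl : d = d' := Int.dvd_antisymm hd.le hd'.le h1 h2
  refine ⟨rfl, ?_⟩
  have hc' : c' = ε * (e * r * a + s * c) :=
    mul_left_cancel₀ hd.ne' (by linear_combination hc)
  have : a' * c' - (p * s - q * (d * e * r)) * (a * c)
      = d * (q * c * (e * r * a + s * c) + q * e * r * (a * c)) + e * (p * a * r * a) := by
    rw [ha, hc']
    linear_combination (p * a + q * (d * c)) * (e * r * a + s * c) * hε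
  rw [this]
  exact dvd_add ((Int.gcd_dvd_left ..).mul_right _) ((Int.gcd_dvd_right ..).mul_right _)

theorem IsCoprime.exists_units_of_mul_eq_mul {a c a' c' : ℤ} (h : IsCoprime a c)
    (h' : IsCoprime a' c') (hac : a * c' = a' * c) :
    ∃ ε : ℤˣ, a' = ε * a ∧ c' = ε * c := by
  obtain ⟨u, v, huv⟩ := h
  have ha : a' = (u * a' + v * c') * a := by linear_combination (-a') * huv - v * hac
  have hc : c' = (u * a' + v * c') * c := by linear_combination (-c') * huv + u * hac
  obtain ⟨ε, hε⟩ := h'.isUnit_of_dvd' ⟨a, ha⟩ ⟨c, hc⟩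
  exact ⟨ε, by rw [hε]; exact ha, by rw [hε]; exact hc⟩

theorem Projectivization.exists_isCoprime_eq_mk (x : Projectivization ℚ (Fin 2 → ℚ)) :
    ∃ a c : ℤ, IsCoprime a c ∧
      ∃ h : ![(a : ℚ), (c : ℚ)] ≠ 0, x = Projectivization.mk ℚ ![(a : ℚ), (c : ℚ)] h := by
  induction x using Projectivization.ind with
  | h v hv =>
    set A := (v 0).num * (v 1).den
    set C := (v 1).num * (v 0).den
    have h0 : (v 0).den ≠ 0 := (v 0).den_nz
    have h1 : (v 1).den ≠ 0 := (v 1).den_nz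
    have hg : 0 < Int.gcd A C := by
      rw [Int.gcd_pos_iff]
      by_contra! hAC
      apply hv
      ext i
      fin_cases i
      · simpa [A, h1] using hAC.1
      · simpa [C, h0] using hAC.2
    obtain ⟨a, c, hac, hA, hC⟩ := Int.exists_gcd_one hg
    have hcop := Int.isCoprime_iff_gcd_eq_one.2 hac
    have hne : ![(a : ℚ), (c : ℚ)] ≠ 0 := by
      intro h
      have ha : a = 0 := by simpa using congrFun h 0
      have hc : c = 0 := by simpa using congrFun h 1
      simp [ha, hc] at hac
    refine ⟨a, c, hcop, hne, ?_⟩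
    rw [Projectivization.mk_eq_mk_iff']
    refine ⟨(Int.gcd A C : ℚ) / ((v 0).den * (v 1).den), ?_⟩
    have e0 : v 0 * (v 0).den = (v 0).num := Rat.mul_den_eq_num _
    have e1 : v 1 * (v 1).den = (v 1).num := Rat.mul_den_eq_num _
    have hA' : ((v 0).num : ℚ) * (v 1).den = a * (Int.gcd A C : ℚ) := by exact_mod_cast hA
    have hC' : ((v 1).num : ℚ) * (v 0).den = c * (Int.gcd A C : ℚ) := by exact_mod_cast hC
    ext i
    fin_cases i
    · simp only [Pi.smul_apply, smul_eq_mul, Fin.zero_eta, Matrix.cons_val_zero]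
      field_simp
      linear_combination (-(v 1).den : ℚ) * e0 - hA'
    · simp only [Pi.smul_apply, smul_eq_mul, Fin.mk_one, Matrix.cons_val_one]
      simp only [Matrix.cons_val_fin_one]
      field_simp
      linear_combination (-(v 0).den : ℚ) * e1 - hC'

theorem quotient_zpowers_neg_one_mk_eq_iff {R : Type*} [CommRing R] {u v : Rˣ} :
    (u : Rˣ ⧸ Subgroup.zpowers (-1 : Rˣ)) = v ↔ v = u ∨ v = -u := by
  rw [QuotientGroup.eq, Subgroup.mem_zpowers_iff]
  constructor
  · rintro ⟨k, hk⟩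
    rw [eq_inv_mul_iff_mul_eq] at hk
    rcases Int.even_or_odd k with h | h
    · left; simpa [h.neg_one_zpow] using hk.symm
    · right; simpa [h.neg_one_zpow] using hk.symm
  · rintro (rfl | rfl)
    · exact ⟨0, by simp⟩
    · exact ⟨1, by simp⟩

/-- Labels for the cusps of `Γ₀(N)`: a divisor `d` of `N` and a unit modulo `gcd(d, N/d)` up to
sign. -/
abbrev CuspLabel (N : ℕ) : Type :=
  Σ d : N.divisors, (ZMod (Nat.gcd d (N / d)))ˣ ⧸
    Subgroup.zpowers (-1 : (ZMod (Nat.gcd d (N / d)))ˣ)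

/-- The point `(a : dc)` of `ℙ¹(ℚ)`, in lowest terms and with `c` prime to `N / d`, has label
`(d, ac)`. -/
def HasCuspLabel (N : ℕ) (x : Projectivization ℚ (Fin 2 → ℚ)) (d : N.divisors)
    (q : (ZMod (Nat.gcd d (N / d)))ˣ ⧸ Subgroup.zpowers (-1 : (ZMod (Nat.gcd d (N / d)))ˣ)) :
    Prop :=
  ∃ (a c : ℤ) (u : (ZMod (Nat.gcd d (N / d)))ˣ),
    IsCoprime a ((d : ℕ) * c) ∧ IsCoprime c ((N / d : ℕ) : ℤ) ∧
    (∃ h : ![(a : ℚ), (((d : ℕ) * c : ℤ) : ℚ)] ≠ 0,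
      x = Projectivization.mk ℚ ![(a : ℚ), (((d : ℕ) * c : ℤ) : ℚ)] h) ∧
    (u : ZMod (Nat.gcd d (N / d))) = ((a * c : ℤ) : ZMod (Nat.gcd d (N / d))) ∧ q = u

theorem IsCoprime.exists_unit_zmod_gcd {d e : ℕ} {a c : ℤ} (hac : IsCoprime a (d * c))
    (hce : IsCoprime c e) : ∃ u : (ZMod (Nat.gcd d e))ˣ,
      (u : ZMod (Nat.gcd d e)) = ((a * c : ℤ) : ZMod (Nat.gcd d e)) := by
  have hd : ((Nat.gcd d e : ℕ) : ℤ) ∣ d := by exact_mod_cast Nat.gcd_dvd_left d e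
  have he : ((Nat.gcd d e : ℕ) : ℤ) ∣ e := by exact_mod_cast Nat.gcd_dvd_right d e
  have h : IsCoprime ((Nat.gcd d e : ℕ) : ℤ) (a * c) :=
    ((hac.of_mul_right_left.symm).of_isCoprime_of_dvd_left hd).mul_right
      ((hce.symm).of_isCoprime_of_dvd_left he)
  exact (ZMod.coe_int_isUnit_iff_isCoprime _ _).2 h

theorem cast_mul_div_of_mem_divisors {N : ℕ} (d : N.divisors) :
    (((d : ℕ) : ℤ) * ((N / d : ℕ) : ℤ)) = N := by
  exact_mod_cast Nat.mul_div_cancel' (Nat.dvd_of_mem_divisors d.2)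

theorem exists_hasCuspLabel {N : ℕ} (hN : 0 < N) (x : Projectivization ℚ (Fin 2 → ℚ)) :
    ∃ l : CuspLabel N, HasCuspLabel N x l.1 l.2 := by
  obtain ⟨a, c, hac, h, hx⟩ := Projectivization.exists_isCoprime_eq_mk x
  have hg : 0 < Int.gcd c N := Int.gcd_pos_of_ne_zero_right _ (by exact_mod_cast hN.ne')
  obtain ⟨c₁, e, hce, hc, he⟩ := Int.exists_gcd_one hg
  set d := Int.gcd c N
  have hdN : d ∣ N := by
    have : (d : ℤ) ∣ N := ⟨e, by rw [mul_comm]; exact he⟩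
    exact_mod_cast this
  have he' : ((N / d : ℕ) : ℤ) = e := by
    rw [Int.natCast_div, he]
    exact Int.mul_ediv_cancel _ (by exact_mod_cast hg.ne')
  rw [mul_comm] at hc
  rw [hc] at hac
  have hce' : IsCoprime c₁ ((N / d : ℕ) : ℤ) := by
    rw [he']
    exact Int.isCoprime_iff_gcd_eq_one.2 hce
  obtain ⟨u, hu⟩ := hac.exists_unit_zmod_gcd hce'
  refine ⟨⟨⟨d, Nat.mem_divisors.2 ⟨hdN, hN.ne'⟩⟩, u⟩, a, c₁, u, hac, hce', ?_, hu, rfl⟩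
  simp only [← hc]
  exact ⟨h, hx⟩

theorem exists_point_hasCuspLabel {N : ℕ} (l : CuspLabel N) : ∃ x, HasCuspLabel N x l.1 l.2 := by
  obtain ⟨⟨d, hd⟩, q⟩ := l
  obtain ⟨u, rfl⟩ := QuotientGroup.mk_surjective q
  have hd0 : d ≠ 0 := (Nat.pos_of_mem_divisors hd).ne'
  have : NeZero d := ⟨hd0⟩
  obtain ⟨w, rfl⟩ := ZMod.unitsMap_surjective (Nat.gcd_dvd_left d (N / d)) u
  obtain ⟨a, ha⟩ := ZMod.intCast_surjective (w : ZMod d)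
  have hcop : IsCoprime a ((d : ℤ) * 1) := by
    rw [mul_one]
    exact ((ZMod.coe_int_isUnit_iff_isCoprime a d).1 (ha ▸ w.isUnit)).symm
  have hne : ![(a : ℚ), (((d : ℤ) * 1 : ℤ) : ℚ)] ≠ 0 := fun h ↦ by
    simpa [hd0] using congrFun h 1
  refine ⟨_, a, 1, _, hcop, isCoprime_one_left, ⟨hne, rfl⟩, ?_, rfl⟩
  rw [mul_one, ZMod.unitsMap_val, ← ha, ZMod.cast_intCast (Nat.gcd_dvd_left d (N / d))]

theorem mulVec_map_intCast (γ : Matrix (Fin 2) (Fin 2) ℤ) (a c : ℤ) :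
    (γ.map ((↑) : ℤ → ℚ)).mulVec ![(a : ℚ), (c : ℚ)] =
      ![((γ 0 0 * a + γ 0 1 * c : ℤ) : ℚ), ((γ 1 0 * a + γ 1 1 * c : ℤ) : ℚ)] := by
  ext i
  fin_cases i <;> simp [Matrix.mulVec, dotProduct, Fin.sum_univ_two]

theorem gamma0Rel_of_hasCuspLabel {N : ℕ} {x y : Projectivization ℚ (Fin 2 → ℚ)}
    {l : CuspLabel N} (hx : HasCuspLabel N x l.1 l.2) (hy : HasCuspLabel N y l.1 l.2) : gamma0Rel N x y := by
  obtain ⟨d, q⟩ := l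
  dsimp only at hx hy
  obtain ⟨a, c, u, hac, hce, ⟨h, rfl⟩, hu, rfl⟩ := hx
  obtain ⟨a', c', u', hac', hce', ⟨h', rfl⟩, hu', huu⟩ := hy
  obtain ⟨ε, hε, hdvd⟩ : ∃ ε : ℤ, (ε = 1 ∨ ε = -1) ∧
      ((Int.gcd (d : ℕ) (N / d : ℕ) : ℕ) : ℤ) ∣ (ε * a') * c' - a * c := by
    simp only [Int.gcd_natCast_natCast, ← ZMod.intCast_eq_intCast_iff_dvd_sub]
    rcases quotient_zpowers_neg_one_mk_eq_iff.1 huu with rfl | rfl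
    · exact ⟨1, .inl rfl, by rw [← hu, one_mul, hu']⟩
    · refine ⟨-1, .inr rfl, ?_⟩
      rw [Units.val_neg] at hu'
      rw [← hu, neg_one_mul, neg_mul, Int.cast_neg, ← hu', neg_neg]
  have hac'' : IsCoprime (ε * a') (((d : ℕ) : ℤ) * c') := by
    rcases hε with rfl | rfl
    · simpa using hac'
    · simpa using hac'.neg_left
  have hεε : ε * ε = 1 := by rcases hε with rfl | rfl <;> norm_num
  obtain ⟨p, q, r, s, hdet, h1, h2⟩ :=
    exists_gamma0_matrix_of_dvd_sub hac hce hac'' hce' hdvd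
  rw [cast_mul_div_of_mem_divisors] at hdet h2
  have key : ((!![ε * p, ε * q; N * r, s] : Matrix (Fin 2) (Fin 2) ℤ).map
      ((↑) : ℤ → ℚ)).mulVec ![(a : ℚ), (((d : ℕ) * c : ℤ) : ℚ)] =
        ![(a' : ℚ), (((d : ℕ) * c' : ℤ) : ℚ)] := by
    rw [mulVec_map_intCast]
    congr 2
    · simp only [Matrix.of_apply, Matrix.cons_val', Matrix.cons_val_zero, Matrix.cons_val_one,
        Matrix.cons_val_fin_one]
      linear_combination ε * h1 + a' * hεε
    · simp only [Matrix.of_apply, Matrix.cons_val', Matrix.cons_val_zero, Matrix.cons_val_one,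
        Matrix.cons_val_fin_one]
      rw [h2]
  refine ⟨!![ε * p, ε * q; N * r, s], ?_, by simp, _, h, key ▸ h', rfl, ?_⟩
  · rw [Matrix.det_fin_two_of, show ε * p * s - ε * q * (N * r) = ε by
      linear_combination ε * hdet]
    exact hε
  · simp only [key]

theorem eq_of_gamma0Rel_of_hasCuspLabel {N : ℕ} {x y : Projectivization ℚ (Fin 2 → ℚ)}
    {l l' : CuspLabel N} (hx : HasCuspLabel N x l.1 l.2) (hy : HasCuspLabel N y l'.1 l'.2)
    (hxy : gamma0Rel N x y) : l = l' := by
  obtain ⟨⟨d, hd⟩, q⟩ := l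
  obtain ⟨⟨d', hd'⟩, q'⟩ := l'
  dsimp only at hx hy
  obtain ⟨a, c, u, hac, hce, ⟨h, hxm⟩, hu, rfl⟩ := hx
  obtain ⟨a', c', u', hac', hce', ⟨h', hym⟩, hu', rfl⟩ := hy
  obtain ⟨γ, hdet, ⟨r, hr⟩, v, hv, hw, hxv, hyv⟩ := hxy
  dsimp only at *
  have hN := cast_mul_div_of_mem_divisors ⟨d, hd⟩
  have hN' := cast_mul_div_of_mem_divisors ⟨d', hd'⟩
  dsimp only at hN hN'
  have hdet' : IsUnit γ.det := Int.isUnit_iff.2 hdet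
  rw [← hN] at hr
  have hdeteq : γ.det = γ 0 0 * γ 1 1 - γ 0 1 * (d * (N / d : ℕ) * r) := by
    rw [Matrix.det_fin_two, hr]
  obtain ⟨t, rfl⟩ := (Projectivization.mk_eq_mk_iff' ℚ _ _ hv h).1 (hxv.symm.trans hxm)
  obtain ⟨t', ht'⟩ := (Projectivization.mk_eq_mk_iff' ℚ _ _ h' hw).1 (hym.symm.trans hyv)
  rw [Matrix.mulVec_smul, mulVec_map_intCast, smul_smul] at ht'
  have hprim : IsCoprime (γ 0 0 * a + γ 0 1 * (d * c)) (γ 1 0 * a + γ 1 1 * (d * c)) := by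
    obtain ⟨δ, hδ⟩ := hdet'
    obtain ⟨z, w, hzw⟩ := hac
    have hδδ : (δ : ℤ) * δ = 1 := by
      rcases Int.units_eq_one_or δ with rfl | rfl <;> simp
    rw [Matrix.det_fin_two] at hδ
    refine ⟨δ * (γ 1 1 * z - γ 1 0 * w), δ * (γ 0 0 * w - γ 0 1 * z), ?_⟩
    linear_combination hzw * δ * δ - (z * a + w * (d * c)) * δ * hδ + hδδ
  have hpar : (γ 0 0 * a + γ 0 1 * (d * c)) * (d' * c') =
      a' * (γ 1 0 * a + γ 1 1 * (d * c)) := by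
    have e0 := congrFun ht' 0
    have e1 := congrFun ht' 1
    simp only [Pi.smul_apply, smul_eq_mul, Matrix.cons_val_zero, Matrix.cons_val_one,
      Matrix.cons_val_fin_one] at e0 e1
    have : (((γ 0 0 * a + γ 0 1 * (d * c) : ℤ) : ℚ)) * ((d' * c' : ℤ) : ℚ) =
        (a' : ℚ) * ((γ 1 0 * a + γ 1 1 * (d * c) : ℤ) : ℚ) := by
      rw [← e0, ← e1]; ring
    exact_mod_cast this
  obtain ⟨ε, ha, hc⟩ := hprim.exists_units_of_mul_eq_mul hac' hpar
  rw [hr] at hc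
  obtain ⟨hdd, hdvd⟩ := gamma0_matrix_invariant
    (by exact_mod_cast Nat.pos_of_mem_divisors hd) (by exact_mod_cast Nat.pos_of_mem_divisors hd')
    (hN.trans hN'.symm) hce hce' (hdeteq ▸ hdet') ha hc
  obtain rfl : d = d' := by exact_mod_cast hdd
  congr 1
  rw [quotient_zpowers_neg_one_mk_eq_iff]
  rw [← hdeteq, Int.gcd_natCast_natCast, ← ZMod.intCast_eq_intCast_iff_dvd_sub, ← hu'] at hdvd
  refine hdet.imp (fun h1 ↦ Units.ext ?_) (fun h1 ↦ Units.ext ?_)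
  · rw [← hdvd, h1, one_mul, hu]
  · rw [← hdvd, h1, neg_one_mul, Int.cast_neg, Units.val_neg, hu]

theorem gamma0Rel_refl (N : ℕ) (x : Projectivization ℚ (Fin 2 → ℚ)) : gamma0Rel N x x := by
  induction x using Projectivization.ind with
  | h v hv => exact ⟨1, by simp, by simp, v, hv, by simpa using hv, rfl, by simp⟩

/-- The number of orbits of `Γ₀(N)` on `ℙ¹(ℚ)` is `∑_{d ∣ N} φᵤ(gcd(d, N/d))`. -/
theorem gamma0_orbit_count (N : ℕ) (hN : 0 < N) :
    Nat.card (Quot (gamma0Rel N)) = ∑ d ∈ N.divisors, phiU (Nat.gcd d (N / d)) := by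
  choose f hf using exists_hasCuspLabel hN
  let F : Quot (gamma0Rel N) → CuspLabel N :=
    Quot.lift f fun x y hxy ↦ eq_of_gamma0Rel_of_hasCuspLabel (hf x) (hf y) hxy
  have hF : Function.Bijective F := by
    constructor
    · rintro ⟨x⟩ ⟨y⟩ (hxy : f x = f y)
      exact Quot.sound (gamma0Rel_of_hasCuspLabel (hf x) (hxy ▸ hf y))
    · intro l
      obtain ⟨x, hx⟩ := exists_point_hasCuspLabel l
      exact ⟨Quot.mk _ x, eq_of_gamma0Rel_of_hasCuspLabel (hf x) hx (gamma0Rel_refl N x)⟩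
  have (d : N.divisors) : NeZero (Nat.gcd d (N / d)) :=
    ⟨(Nat.gcd_pos_of_pos_left _ (Nat.pos_of_mem_divisors d.2)).ne'⟩
  rw [Nat.card_eq_of_bijective F hF, Nat.card_sigma,
    ← Finset.sum_coe_sort N.divisors fun d ↦ phiU (Nat.gcd d (N / d))]
  rfl

end
end

section
/- Let K be a number field with ring of integers O_K. The number of orbits of GL₂(O_K) acting on the projective line ℙ¹(K) by fractional linear transformations equals the class number h(K) = #ClassGroup(O_K). -/
noncomputable section

/-- Two points of `ℙ¹(K)` are related if some `γ ∈ GL₂(O_K)` (a matrix over the ring of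
integers that is invertible over `O_K`) carries one to the other by fractional linear
transformation. -/
def gl2OKRel (K : Type) [Field K] [NumberField K]
    (x y : Projectivization K (Fin 2 → K)) : Prop :=
  ∃ γ : Matrix (Fin 2) (Fin 2) (NumberField.RingOfIntegers K),
    IsUnit γ.det ∧
    ∃ (v : Fin 2 → K) (hv : v ≠ 0)
      (hw : (γ.map (algebraMap (NumberField.RingOfIntegers K) K)).mulVec v ≠ 0),
      x = Projectivization.mk K v hv ∧
      y = Projectivization.mk K
        ((γ.map (algebraMap (NumberField.RingOfIntegers K) K)).mulVec v) hw

open scoped nonZeroDivisors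

section Dedekind

variable {R K : Type*} [CommRing R] [Field K] [Algebra R K] [IsFractionRing R K]

variable (R) in
/-- The fractional ideal generated by the two coordinates of a vector. -/
def coordIdeal (v : Fin 2 → K) : FractionalIdeal R⁰ K :=
  FractionalIdeal.spanSingleton R⁰ (v 0) + FractionalIdeal.spanSingleton R⁰ (v 1)

lemma mem_coordIdeal {v : Fin 2 → K} {x : K} :
    x ∈ coordIdeal R v ↔ ∃ a b : R, a • v 0 + b • v 1 = x := by
  simp [coordIdeal, FractionalIdeal.mem_add, FractionalIdeal.mem_spanSingleton]

lemma apply_mem_coordIdeal (v : Fin 2 → K) (i : Fin 2) : v i ∈ coordIdeal R v := by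
  rw [mem_coordIdeal]
  fin_cases i
  · exact ⟨1, 0, by simp⟩
  · exact ⟨0, 1, by simp⟩

lemma coordIdeal_le {v : Fin 2 → K} {I : FractionalIdeal R⁰ K} (h : ∀ i, v i ∈ I) :
    coordIdeal R v ≤ I := by
  intro x hx
  obtain ⟨a, b, rfl⟩ := mem_coordIdeal.mp hx
  exact (I : Submodule R K).add_mem ((I : Submodule R K).smul_mem a (h 0))
    ((I : Submodule R K).smul_mem b (h 1))

lemma coordIdeal_ne_zero {v : Fin 2 → K} (hv : v ≠ 0) : coordIdeal R v ≠ 0 := by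
  intro h
  refine hv (funext fun i => ?_)
  have hi := apply_mem_coordIdeal (R := R) v i
  rwa [h, FractionalIdeal.mem_zero_iff] at hi

lemma coordIdeal_smul (c : K) (v : Fin 2 → K) :
    coordIdeal R (c • v) = FractionalIdeal.spanSingleton R⁰ c * coordIdeal R v := by
  simp [coordIdeal, mul_add, FractionalIdeal.spanSingleton_mul_spanSingleton]

lemma coordIdeal_mulVec_le (γ : Matrix (Fin 2) (Fin 2) R) (v : Fin 2 → K) :
    coordIdeal R ((γ.map (algebraMap R K)).mulVec v) ≤ coordIdeal R v := by
  refine coordIdeal_le fun i => mem_coordIdeal.mpr ⟨γ i 0, γ i 1, ?_⟩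
  simp [Matrix.mulVec, dotProduct, Fin.sum_univ_two, Algebra.smul_def]

lemma coordIdeal_mulVec {γ : Matrix (Fin 2) (Fin 2) R} (hγ : IsUnit γ.det) (v : Fin 2 → K) :
    coordIdeal R ((γ.map (algebraMap R K)).mulVec v) = coordIdeal R v := by
  refine (coordIdeal_mulVec_le γ v).antisymm ?_
  have h := coordIdeal_mulVec_le γ⁻¹ ((γ.map (algebraMap R K)).mulVec v)
  rwa [Matrix.mulVec_mulVec, ← Matrix.map_mul, Matrix.nonsing_inv_mul _ hγ,
    Matrix.map_one _ (map_zero _) (map_one _), Matrix.one_mulVec] at h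

lemma ClassGroup.mk_eq_mk_iff_exists_spanSingleton_mul [IsDomain R]
    {I J : (FractionalIdeal R⁰ K)ˣ} :
    ClassGroup.mk K I = ClassGroup.mk K J ↔
      ∃ c : Kˣ, FractionalIdeal.spanSingleton R⁰ (c : K) * I = J := by
  rw [← (ClassGroup.equiv K).injective.eq_iff, ClassGroup.equiv_mk, ClassGroup.equiv_mk,
    QuotientGroup.mk'_eq_mk']
  simp only [MonoidHom.mem_range, exists_exists_eq_and]
  simp [Units.ext_iff, -toPrincipalIdeal_eq_iff, mul_comm]

variable [IsDedekindDomain R]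

lemma exists_inv_coordIdeal_pairing {v : Fin 2 → K} (hv : v ≠ 0) :
    ∃ p ∈ (coordIdeal R v)⁻¹, ∃ q ∈ (coordIdeal R v)⁻¹, v 0 * p + v 1 * q = 1 := by
  have h : (1 : K) ∈ coordIdeal R v * (coordIdeal R v)⁻¹ := by
    rw [mul_inv_cancel₀ (coordIdeal_ne_zero hv)]
    exact FractionalIdeal.one_mem_one _
  nth_rw 1 [coordIdeal] at h
  rw [add_mul, FractionalIdeal.mem_add] at h
  obtain ⟨_, hi, _, hj, h⟩ := h
  obtain ⟨p, hp, rfl⟩ := FractionalIdeal.mem_singleton_mul.mp hi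
  obtain ⟨q, hq, rfl⟩ := FractionalIdeal.mem_singleton_mul.mp hj
  exact ⟨p, hp, q, hq, h⟩

/-- Vectors whose coordinates generate the same fractional ideal differ by an integral matrix of
determinant one. -/
lemma exists_mulVec_eq_of_coordIdeal_eq {v w : Fin 2 → K} (hv : v ≠ 0) (hw : w ≠ 0)
    (h : coordIdeal R v = coordIdeal R w) :
    ∃ γ : Matrix (Fin 2) (Fin 2) R, γ.det = 1 ∧ (γ.map (algebraMap R K)).mulVec v = w := by
  obtain ⟨p, hp, q, hq, hpq⟩ := exists_inv_coordIdeal_pairing (R := R) hv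
  obtain ⟨r, hr, s, hs, hrs⟩ := exists_inv_coordIdeal_pairing (R := R) hw
  have key {x y : K} (hx : x ∈ coordIdeal R v) (hy : y ∈ (coordIdeal R v)⁻¹) :
      ∃ a : R, algebraMap R K a = x * y := by
    have hxy := FractionalIdeal.mul_mem_mul hx hy
    rwa [mul_inv_cancel₀ (coordIdeal_ne_zero hv), FractionalIdeal.mem_one_iff] at hxy
  have hvi := apply_mem_coordIdeal (R := R) v
  have hwi := apply_mem_coordIdeal (R := R) w
  rw [← h] at hr hs hwi
  obtain ⟨a₁, ha₁⟩ := key (hwi 0) hp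
  obtain ⟨a₂, ha₂⟩ := key (hvi 1) hs
  obtain ⟨b₁, hb₁⟩ := key (hwi 0) hq
  obtain ⟨b₂, hb₂⟩ := key (hvi 0) hs
  obtain ⟨c₁, hc₁⟩ := key (hwi 1) hp
  obtain ⟨c₂, hc₂⟩ := key (hvi 1) hr
  obtain ⟨d₁, hd₁⟩ := key (hwi 1) hq
  obtain ⟨d₂, hd₂⟩ := key (hvi 0) hr
  refine ⟨!![a₁ + a₂, b₁ - b₂; c₁ - c₂, d₁ + d₂], ?_, ?_⟩
  · apply IsFractionRing.injective R K
    simp only [Matrix.det_fin_two_of, map_sub, map_mul, map_add, map_one, *]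
    linear_combination (w 0 * r + w 1 * s) * hpq + hrs
  · ext i
    fin_cases i
    · simp [Matrix.mulVec, dotProduct, Fin.sum_univ_two, *]
      linear_combination w 0 * hpq
    · simp [Matrix.mulVec, dotProduct, Fin.sum_univ_two, *]
      linear_combination w 1 * hpq

variable (R) in
/-- The ideal class of the fractional ideal generated by the homogeneous coordinates of a point of
the projective line. -/
def Projectivization.idealClass (x : Projectivization K (Fin 2 → K)) : ClassGroup R :=
  Projectivization.lift
    (fun v : {v : Fin 2 → K // v ≠ 0} =>
      ClassGroup.mk K (Units.mk0 (coordIdeal R v.1) (coordIdeal_ne_zero v.2)))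
    (fun v w t h => by
      have ht : t ≠ 0 := by
        rintro rfl
        exact v.2 (by simpa using h)
      refine (ClassGroup.mk_eq_mk_iff_exists_spanSingleton_mul.mpr ⟨Units.mk0 t ht, ?_⟩).symm
      simp [h, coordIdeal_smul]) x

lemma Projectivization.idealClass_mk {v : Fin 2 → K} (hv : v ≠ 0) :
    Projectivization.idealClass R (Projectivization.mk K v hv) =
      ClassGroup.mk K (Units.mk0 (coordIdeal R v) (coordIdeal_ne_zero hv)) :=
  rfl

lemma Projectivization.idealClass_surjective :
    Function.Surjective
      (Projectivization.idealClass R : Projectivization K (Fin 2 → K) → ClassGroup R) := by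
  intro C
  obtain ⟨⟨I, hI⟩, rfl⟩ := ClassGroup.mk0_surjective C
  obtain ⟨x, hxI, hx⟩ := Submodule.exists_mem_ne_zero_of_ne_bot (nonZeroDivisors.ne_zero hI)
  obtain ⟨y, rfl⟩ := IsDedekindDomain.exists_eq_span_pair hxI hx
  have hv : ![algebraMap R K x, algebraMap R K y] ≠ 0 := fun h =>
    hx (IsFractionRing.injective R K (by simpa using congrFun h 0))
  refine ⟨Projectivization.mk K _ hv, ?_⟩
  rw [Projectivization.idealClass_mk, ← ClassGroup.mk_mk0 K]
  congr 1
  ext1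
  simp [coordIdeal, Ideal.span_insert, FractionalIdeal.coeIdeal_sup,
    FractionalIdeal.coeIdeal_span_singleton]

end Dedekind

lemma idealClass_eq_of_gl2OKRel {K : Type} [Field K] [NumberField K]
    {x y : Projectivization K (Fin 2 → K)} (h : gl2OKRel K x y) :
    x.idealClass (NumberField.RingOfIntegers K) =
      y.idealClass (NumberField.RingOfIntegers K) := by
  obtain ⟨γ, hγ, v, hv, hw, rfl, rfl⟩ := h
  simp only [Projectivization.idealClass_mk, coordIdeal_mulVec hγ]

lemma gl2OKRel_of_idealClass_eq {K : Type} [Field K] [NumberField K]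
    {x y : Projectivization K (Fin 2 → K)}
    (h : x.idealClass (NumberField.RingOfIntegers K) =
      y.idealClass (NumberField.RingOfIntegers K)) : gl2OKRel K x y := by
  induction x using Projectivization.ind with | h v hv
  induction y using Projectivization.ind with | h w hw
  rw [Projectivization.idealClass_mk, Projectivization.idealClass_mk,
    ClassGroup.mk_eq_mk_iff_exists_spanSingleton_mul] at h
  obtain ⟨c, hc⟩ := h
  rw [Units.val_mk0, Units.val_mk0, ← coordIdeal_smul] at hc
  have hcv : (c : K) • v ≠ 0 := smul_ne_zero c.ne_zero hv
  obtain ⟨γ, hγ, rfl⟩ := exists_mulVec_eq_of_coordIdeal_eq hcv hw hc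
  refine ⟨γ, hγ ▸ isUnit_one, (c : K) • v, hcv, hw, ?_, rfl⟩
  rw [Projectivization.mk_eq_mk_iff]
  exact ⟨c⁻¹, by simp [Units.smul_def]⟩

/-- (Bianchi) The number of orbits of `GL₂(O_K)` on `ℙ¹(K)` is the class number of `K`. -/
theorem gl2OK_orbit_count (K : Type) [Field K] [NumberField K] :
    Nat.card (Quot (gl2OKRel K)) =
      Nat.card (ClassGroup (NumberField.RingOfIntegers K)) := by
  refine Nat.card_congr (Equiv.ofBijective
    (Quot.lift (Projectivization.idealClass (NumberField.RingOfIntegers K))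
      fun _ _ => idealClass_eq_of_gl2OKRel) ⟨?_, ?_⟩)
  · rintro ⟨x⟩ ⟨y⟩ h
    exact Quot.sound (gl2OKRel_of_idealClass_eq h)
  · intro C
    obtain ⟨x, rfl⟩ := Projectivization.idealClass_surjective (K := K) C
    exact ⟨Quot.mk _ x, rfl⟩

end
end

section
/- Let K be an imaginary quadratic field whose only roots of unity are ±1. For every positive integer f, the number of orbits of GL₂(O_f) acting on ℙ¹(K) by fractional linear transformations equals ∑_{ℓ ∣ f} h_ℓ · φ_u(f/ℓ). -/
noncomputable section

variable (K : Type) [Field K] [NumberField K]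

/-- The underlying set of the order `ℤ + m·O_K` of conductor `m` in `K`. -/
def orderSet (m : ℕ) : Set K :=
  {x : K | ∃ (a : ℤ) (y : NumberField.RingOfIntegers K),
    x = (a : K) + (m : K) * algebraMap (NumberField.RingOfIntegers K) K y}

/-- The order `ℤ + m·O_K` of conductor `m`, as a subring of `K`. -/
def orderSubring (m : ℕ) : Subring K where
  carrier := orderSet K m
  add_mem' := by
    rintro x y ⟨a, u, rfl⟩ ⟨b, v, rfl⟩
    exact ⟨a + b, u + v, by rw [map_add]; push_cast; ring⟩
  zero_mem' := ⟨0, 0, by simp⟩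
  one_mem' := ⟨1, 0, by simp⟩
  neg_mem' := by
    rintro x ⟨a, u, rfl⟩
    exact ⟨-a, -u, by rw [map_neg]; push_cast; ring⟩
  mul_mem' := by
    rintro x y ⟨a, u, rfl⟩ ⟨b, v, rfl⟩
    refine ⟨a * b, a • v + b • u + (m : ℤ) • (u * v), ?_⟩
    rw [map_add, map_add, map_zsmul, map_zsmul, map_zsmul, map_mul]
    rw [zsmul_eq_mul, zsmul_eq_mul, zsmul_eq_mul]
    push_cast
    ring

/-- Two points of `ℙ¹(K)` are related if some `γ ∈ GL₂(O_f)` (a matrix over the order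
`O_f = ℤ + f·O_K` that is invertible over `O_f`) carries one to the other by fractional
linear transformation. -/
def gl2OrderRel (f : ℕ) (x y : Projectivization K (Fin 2 → K)) : Prop :=
  ∃ γ : Matrix (Fin 2) (Fin 2) (orderSubring K f),
    IsUnit γ.det ∧
    ∃ (v : Fin 2 → K) (hv : v ≠ 0)
      (hw : (γ.map ((orderSubring K f).subtype)).mulVec v ≠ 0),
      x = Projectivization.mk K v hv ∧
      y = Projectivization.mk K ((γ.map ((orderSubring K f).subtype)).mulVec v) hw

section QuadraticOrders

theorem exists_pair_of_finrank_eq_two {N : Type*} [AddCommGroup N] [Module.Free ℤ N]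
    [Module.Finite ℤ N] (h : Module.finrank ℤ N = 2) :
    ∃ x y : N, (∀ z, ∃ a b : ℤ, z = a • x + b • y) ∧
      ∀ a b : ℤ, a • x + b • y = 0 → a = 0 ∧ b = 0 := by
  let β := Module.finBasisOfFinrankEq ℤ N h
  refine ⟨β 0, β 1, fun z => ⟨β.repr z 0, β.repr z 1, ?_⟩, fun a b hab => ?_⟩
  · conv_lhs => rw [← β.sum_repr z]
    rw [Fin.sum_univ_two]
  · have := Fintype.linearIndependent_iff.1 β.linearIndependent ![a, b]
      (by simpa [Fin.sum_univ_two] using hab)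
    exact ⟨by simpa using this 0, by simpa using this 1⟩

variable {K}

/-- `1, ω` is a `ℤ`-basis of the ring of integers of the quadratic field `K`, and
`ω ^ 2 = t * ω - n`. -/
structure IsQuadGen (ω : K) (t n : ℤ) : Prop where
  sq : ω ^ 2 = t * ω - n
  int : ∀ x : K, IsIntegral ℤ x ↔ ∃ a b : ℤ, x = a + b * ω
  indep : ∀ a b : ℤ, (a : K) + b * ω = 0 → a = 0 ∧ b = 0
  frac : ∀ x : K, ∃ a b d : ℤ, d ≠ 0 ∧ d * x = a + b * ω

theorem exists_isQuadGen (hdeg : Module.finrank ℚ K = 2) :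
    ∃ (ω : K) (t n : ℤ), IsQuadGen ω t n := by
  have hfr : Module.finrank ℤ (NumberField.RingOfIntegers K) = 2 := by
    rw [NumberField.RingOfIntegers.rank, hdeg]
  obtain ⟨β₀, β₁, hβ, hind⟩ := exists_pair_of_finrank_eq_two hfr
  obtain ⟨p, q, h1⟩ := hβ 1
  have hcop : IsCoprime p q := by
    rw [Int.isCoprime_iff_gcd_eq_one]
    set d := Int.gcd p q with hd
    obtain ⟨p', hp'⟩ : (d : ℤ) ∣ p := Int.gcd_dvd_left ..
    obtain ⟨q', hq'⟩ : (d : ℤ) ∣ q := Int.gcd_dvd_right ..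
    obtain ⟨a, b, hab⟩ := hβ ((p' • β₀ + q' • β₁) * β₀)
    have hu : β₀ = (d * a) • β₀ + (d * b) • β₁ := by
      rw [mul_smul, mul_smul, ← smul_add, ← hab, ← smul_mul_assoc, smul_add, smul_smul,
        smul_smul, ← hp', ← hq', ← h1, one_mul]
    have hda := (hind (d * a - 1) (d * b) (by
      rw [sub_smul, one_smul, sub_add_eq_add_sub, ← hu, sub_self])).1
    have hdi : (d : ℤ) ∣ 1 := ⟨a, by linarith⟩
    exact_mod_cast Int.eq_one_of_dvd_one (by positivity) hdi
  obtain ⟨x, y, hxy⟩ := hcop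
  set w : NumberField.RingOfIntegers K := -y • β₀ + x • β₁ with hw
  have hxyR : (x : NumberField.RingOfIntegers K) * p + y * q = 1 := by exact_mod_cast hxy
  have hb0 : β₀ = x - q * w := by
    have : (x : NumberField.RingOfIntegers K) = x * (p • β₀ + q • β₁) := by rw [← h1, mul_one]
    rw [this, hw]
    simp only [zsmul_eq_mul]
    push_cast
    linear_combination -(β₀) * hxyR
  have hb1 : β₁ = y + p * w := by
    have : (y : NumberField.RingOfIntegers K) = y * (p • β₀ + q • β₁) := by rw [← h1, mul_one]
    rw [this, hw]
    simp only [zsmul_eq_mul]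
    push_cast
    linear_combination -(β₁) * hxyR
  have hrep : ∀ z : NumberField.RingOfIntegers K, ∃ a b : ℤ, z = a + b * w := fun z => by
    obtain ⟨a, b, h⟩ := hβ z
    refine ⟨a * x + b * y, b * p - a * q, ?_⟩
    rw [h, hb0, hb1]
    simp only [zsmul_eq_mul]
    push_cast
    ring
  have hindw : ∀ a b : ℤ, (a : NumberField.RingOfIntegers K) + b * w = 0 → a = 0 ∧ b = 0 := by
    intro a b h
    have h2 := hind (a * p - b * y) (a * q + b * x) (by
      rw [← h, hw, ← mul_one (a : NumberField.RingOfIntegers K), h1]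
      simp only [zsmul_eq_mul]
      push_cast
      ring)
    constructor
    · linear_combination x * h2.1 + y * h2.2 - a * hxy
    · linear_combination p * h2.2 - q * h2.1 - b * hxy
  obtain ⟨n, t, hsq⟩ := hrep (w ^ 2)
  refine ⟨w, t, -n, ?_, ?_, ?_, ?_⟩
  · have := congrArg (algebraMap (NumberField.RingOfIntegers K) K) hsq
    simp only [map_add, map_mul, map_pow, map_intCast] at this
    rw [this]
    push_cast
    ring
  · intro z
    constructor
    · intro hz
      obtain ⟨a, b, h⟩ := hrep ⟨z, hz⟩
      refine ⟨a, b, ?_⟩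
      have := congrArg (algebraMap (NumberField.RingOfIntegers K) K) h
      rw [map_add, map_mul, map_intCast, map_intCast] at this
      exact this
    · rintro ⟨a, b, rfl⟩
      have := NumberField.RingOfIntegers.isIntegral_coe
        ((a : NumberField.RingOfIntegers K) + (b : NumberField.RingOfIntegers K) * w)
      rw [map_add, map_mul, map_intCast, map_intCast] at this
      exact this
  · intro a b h
    apply hindw
    apply NumberField.RingOfIntegers.coe_injective
    rw [map_add, map_mul, map_intCast, map_intCast, map_zero]
    exact h
  · intro z
    obtain ⟨d, hd, hz⟩ := ((IsFractionRing.isAlgebraic_iff ℤ ℚ K).2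
      (IsAlgebraic.of_finite ℚ z)).exists_integral_multiple
    obtain ⟨a, b, h⟩ := hrep ⟨d • z, hz⟩
    refine ⟨a, b, d, hd, ?_⟩
    have := congrArg (algebraMap (NumberField.RingOfIntegers K) K) h
    rw [map_add, map_mul, map_intCast, map_intCast] at this
    rw [← zsmul_eq_mul]
    exact this

theorem IsQuadGen.mem_order {L : Type} [Field L] {ω : L} {t n : ℤ} (h : IsQuadGen ω t n)
    (m : ℕ) (x : L) :
    x ∈ orderSubring L m ↔ ∃ a b : ℤ, x = a + b * (m * ω) := by
  change x ∈ orderSet L m ↔ _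
  constructor
  · rintro ⟨a, y, rfl⟩
    obtain ⟨b, c, hy⟩ := (h.int y).1 (NumberField.RingOfIntegers.isIntegral_coe y)
    refine ⟨a + m * b, c, ?_⟩
    change (a : L) + m * (y : L) = _
    rw [hy]
    push_cast
    ring
  · rintro ⟨a, b, rfl⟩
    refine ⟨a, ⟨b * ω, (h.int _).2 ⟨0, b, by simp⟩⟩, ?_⟩
    change _ = (a : L) + m * (b * ω)
    ring

theorem eq_one_or_neg_one_of_mul_eq_one (hdeg : Module.finrank ℚ K = 2)
    (himag : IsEmpty (K →+* ℝ))
    (hroots : ∀ x : K, (∃ n : ℕ, 0 < n ∧ x ^ n = 1) → x = 1 ∨ x = -1)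
    {x y : K} (hx : IsIntegral ℤ x) (hy : IsIntegral ℤ y) (hxy : x * y = 1) :
    x = 1 ∨ x = -1 := by
  have hreal : NumberField.InfinitePlace.nrRealPlaces K = 0 := by
    rw [NumberField.nrRealPlaces_eq_zero_iff, NumberField.isTotallyComplex_iff]
    intro w
    by_contra hw
    exact himag.false (NumberField.InfinitePlace.embedding_of_isReal
      (NumberField.InfinitePlace.not_isComplex_iff_isReal.1 hw))
  have hcard : Fintype.card (NumberField.InfinitePlace K) = 1 := by
    have h1 := NumberField.InfinitePlace.card_add_two_mul_card_eq_rank K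
    have h2 := NumberField.InfinitePlace.card_eq_nrRealPlaces_add_nrComplexPlaces K
    omega
  have hsub : Subsingleton (NumberField.InfinitePlace K) :=
    (Fintype.card_le_one_iff_subsingleton.1 hcard.le)
  let u : (NumberField.RingOfIntegers K)ˣ :=
    ⟨⟨x, hx⟩, ⟨y, hy⟩, NumberField.RingOfIntegers.coe_injective hxy,
      NumberField.RingOfIntegers.coe_injective ((mul_comm y x).trans hxy)⟩
  have hu : u ∈ NumberField.Units.torsion K := by
    rw [← NumberField.Units.dirichletUnitTheorem.logEmbedding_eq_zero_iff]
    ext w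
    exact (w.2 (Subsingleton.elim _ _)).elim
  obtain ⟨k, hk, hpow⟩ := isOfFinOrder_iff_pow_eq_one.1 ((CommGroup.mem_torsion u).1 hu)
  refine hroots x ⟨k, hk, ?_⟩
  have := congrArg (fun v : (NumberField.RingOfIntegers K)ˣ =>
    algebraMap (NumberField.RingOfIntegers K) K v) hpow
  simp only [Units.val_pow_eq_pow_val, map_pow, Units.val_one, map_one] at this
  exact this

/-- `e₁, e₂` is a `ℤ`-basis of the lattice `M`. -/
structure IsLatticeBasis {L : Type} [Field L] (M : Set L) (e₁ e₂ : L) : Prop where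
  mem_iff : ∀ z, z ∈ M ↔ ∃ p q : ℤ, z = p * e₁ + q * e₂
  indep : ∀ p q : ℤ, p * e₁ + q * e₂ = 0 → p = 0 ∧ q = 0

theorem exists_isLatticeBasis (hdeg : Module.finrank ℚ K = 2) {ω : K} {t n : ℤ}
    (h : IsQuadGen ω t n) (M : Submodule ℤ K) (hM : M.FG) {x : K} (hx0 : x ≠ 0) (hx : x ∈ M)
    {k : ℤ} (hk : k ≠ 0) (hkx : k * ω * x ∈ M) :
    ∃ e₁ e₂, IsLatticeBasis (M : Set K) e₁ e₂ := by
  have : Module.Finite ℤ M := Module.Finite.iff_fg.2 hM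
  have : FiniteDimensional ℚ K := NumberField.to_finiteDimensional
  have hle : Module.finrank ℤ M ≤ 2 := by
    let β := Module.finBasis ℤ M
    have h1 : LinearIndependent ℤ (M.subtype ∘ β) :=
      β.linearIndependent.map' M.subtype (Submodule.ker_subtype M)
    have h2 : LinearIndependent ℚ (M.subtype ∘ β) := (LinearIndependent.iff_fractionRing ℤ ℚ).1 h1
    simpa [hdeg] using h2.fintype_card_le_finrank
  have hge : 2 ≤ Module.finrank ℤ M := by
    have h1 : LinearIndependent ℤ ![(⟨x, hx⟩ : M), ⟨k * ω * x, hkx⟩] := by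
      rw [LinearIndependent.pair_iff]
      intro a b hab
      have h2 : (a : K) * x + b * (k * ω * x) = 0 := by
        simpa [zsmul_eq_mul] using congrArg (M.subtype) hab
      have h3 : ((a : ℤ) : K) + ((b * k : ℤ) : K) * ω = 0 := by
        apply mul_right_cancel₀ hx0
        push_cast
        linear_combination h2
      have h4 := h.indep _ _ h3
      exact ⟨h4.1, (mul_eq_zero.1 h4.2).resolve_right hk⟩
    simpa using h1.fintype_card_le_finrank
  obtain ⟨e₁, e₂, hs, hi⟩ := exists_pair_of_finrank_eq_two (le_antisymm hle hge)
  refine ⟨e₁, e₂, fun z => ⟨fun hz => ?_, ?_⟩, fun p q hpq => hi p q ?_⟩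
  · obtain ⟨a, b, hab⟩ := hs ⟨z, hz⟩
    exact ⟨a, b, by simpa [zsmul_eq_mul] using congrArg (M.subtype) hab⟩
  · rintro ⟨p, q, rfl⟩
    rw [← zsmul_eq_mul, ← zsmul_eq_mul]
    exact M.add_mem (M.smul_mem p e₁.2) (M.smul_mem q e₂.2)
  · apply Subtype.ext
    simpa [zsmul_eq_mul] using hpq

/-- `M` is homothetic to `ℤ A + ℤ (r + ℓ ω)`, where `A` is the leading coefficient of the
primitive form `(A, 2 r + ℓ t, C)` with `A * C` the norm of `r + ℓ ω`. -/
def IsPrimitiveLattice {L : Type} [Field L] (ω : L) (t n : ℤ) (ℓ : ℕ) (M : Set L) : Prop :=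
  ∃ (c : L) (A r C u v w : ℤ), c ≠ 0 ∧ A ≠ 0 ∧ A * C = r ^ 2 + r * ℓ * t + ℓ ^ 2 * n ∧
    u * A + v * (2 * r + ℓ * t) + w * C = 1 ∧ IsLatticeBasis M (c * A) (c * (r + ℓ * ω))

section Lattice

variable {L : Type} [Field L] {ω : L} {t n : ℤ}

theorem IsQuadGen.charZero (h : IsQuadGen ω t n) : CharZero L :=
  charZero_of_inj_zero fun k hk => by
    have := (h.indep k 0 (by simpa using hk)).1
    exact_mod_cast this

theorem exists_primitive_triple {a b c : ℤ} (ha : a ≠ 0) :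
    ∃ g a' b' c' u v w : ℤ, a = g * a' ∧ b = g * b' ∧ c = g * c' ∧
      u * a' + v * b' + w * c' = 1 := by
  have hg0 : (Int.gcd a (Int.gcd b c) : ℤ) ≠ 0 := by
    rw [Ne, Int.natCast_eq_zero, Int.gcd_eq_zero_iff]
    exact fun h => ha h.1
  have h1 := Int.gcd_eq_gcd_ab a (Int.gcd b c)
  have h2 := Int.gcd_eq_gcd_ab b c
  obtain ⟨a', ha'⟩ : (Int.gcd a (Int.gcd b c) : ℤ) ∣ a := Int.gcd_dvd_left ..
  have h3 : (Int.gcd a (Int.gcd b c) : ℤ) ∣ Int.gcd b c := Int.gcd_dvd_right ..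
  obtain ⟨b', hb'⟩ := h3.trans (Int.gcd_dvd_left ..)
  obtain ⟨c', hc'⟩ := h3.trans (Int.gcd_dvd_right ..)
  generalize (Int.gcd a (Int.gcd b c) : ℤ) = g at *
  refine ⟨g, a', b', c', Int.gcdA a (Int.gcd b c), Int.gcdB a (Int.gcd b c) * Int.gcdA b c,
    Int.gcdB a (Int.gcd b c) * Int.gcdB b c, ha', hb', hc', mul_left_cancel₀ hg0 ?_⟩
  linear_combination -h1 - Int.gcdB a (Int.gcd b c) * h2 - Int.gcdA a (Int.gcd b c) * ha'
    - Int.gcdB a (Int.gcd b c) * Int.gcdA b c * hb' - Int.gcdB a (Int.gcd b c) * Int.gcdB b c * hc'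

theorem IsLatticeBasis.neg_right {M : Set L} {e₁ e₂ : L} (h : IsLatticeBasis M e₁ e₂) :
    IsLatticeBasis M e₁ (-e₂) := by
  refine ⟨fun z => (h.mem_iff z).trans ⟨?_, ?_⟩, fun p q hpq => ?_⟩
  · rintro ⟨p, q, rfl⟩
    exact ⟨p, -q, by push_cast; ring⟩
  · rintro ⟨p, q, rfl⟩
    exact ⟨p, -q, by push_cast; ring⟩
  · have := h.indep p (-q) (by push_cast; linear_combination hpq)
    exact ⟨this.1, neg_eq_zero.1 this.2⟩

theorem IsLatticeBasis.isPrimitiveLattice (h : IsQuadGen ω t n) {M : Set L} {e₁ e₂ : L}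
    (he : IsLatticeBasis M e₁ e₂) : ∃ ℓ : ℕ, 0 < ℓ ∧ IsPrimitiveLattice ω t n ℓ M := by
  have := h.charZero
  have he₁ : e₁ ≠ 0 := by
    rintro rfl
    have := (he.indep 1 0 (by simp)).1
    omega
  obtain ⟨x, y, d, hd, hdxy⟩ := h.frac (e₂ / e₁)
  have hxy : (d : L) * e₂ = e₁ * (x + y * ω) := by
    rw [← hdxy]
    field_simp
  have hy : y ≠ 0 := by
    rintro rfl
    refine hd (he.indep (-x) d ?_).2
    push_cast at hxy ⊢
    linear_combination hxy
  obtain ⟨g, A, B, C, u, v, w, hA, hB, hC, huvw⟩ := exists_primitive_triple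
    (a := d ^ 2) (b := d * (2 * x + y * t)) (c := x ^ 2 + x * y * t + y ^ 2 * n) (pow_ne_zero 2 hd)
  have hg : g ≠ 0 := by
    rintro rfl
    exact pow_ne_zero 2 hd (by rw [hA, zero_mul])
  have hA0 : A ≠ 0 := by
    rintro rfl
    exact pow_ne_zero 2 hd (by rw [hA, mul_zero])
  have hgL : (g : L) ≠ 0 := by exact_mod_cast hg
  have hdL : (d : L) ≠ 0 := by exact_mod_cast hd
  have hAL : (A : L) ≠ 0 := by exact_mod_cast hA0
  have hA' : (d : L) ^ 2 = g * A := by exact_mod_cast hA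
  have hB' : (d : L) * (2 * x + y * t) = g * B := by exact_mod_cast hB
  have hC' : (x : L) ^ 2 + x * y * t + y ^ 2 * n = g * C := by exact_mod_cast hC
  have hint : IsIntegral ℤ ((d : L) * (x + y * ω) / g) := by
    refine ⟨.X ^ 2 + .C (-B) * .X + .C (A * C), ?_, ?_⟩
    · monicity!
    · simp only [Polynomial.eval₂_add, Polynomial.eval₂_mul, Polynomial.eval₂_pow,
        Polynomial.eval₂_X, Polynomial.eval₂_C]
      simp only [algebraMap_int_eq, eq_intCast]
      push_cast
      field_simp
      linear_combination (d : L) ^ 2 * y ^ 2 * h.sq + (d : L) * (x + y * ω) * hB'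
        - (g : L) * C * hA' - (d : L) ^ 2 * hC'
  obtain ⟨r, s, hrs⟩ := (h.int _).1 hint
  rw [div_eq_iff hgL] at hrs
  have hcomp := h.indep (d * x - g * r) (d * y - g * s) (by
    push_cast
    linear_combination hrs)
  have hr : d * x = g * r := by linarith [hcomp.1]
  have hs : d * y = g * s := by linarith [hcomp.2]
  have hs0 : s ≠ 0 := by
    rintro rfl
    rw [mul_zero] at hs
    exact (mul_ne_zero hd hy) hs
  have hB2 : B = 2 * r + s * t := by
    apply mul_left_cancel₀ hg
    linear_combination -hB + 2 * hr + t * hs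
  have hAC : A * C = r ^ 2 + r * s * t + s ^ 2 * n := by
    apply mul_left_cancel₀ (pow_ne_zero 2 hg)
    linear_combination -(g * C) * hA - d ^ 2 * hC + (d * x + g * r + g * s * t) * hr
      + (d * x * t + n * (d * y + g * s)) * hs
  have hc0 : e₁ / A ≠ 0 := div_ne_zero he₁ hAL
  have h1 : e₁ / A * A = e₁ := div_mul_cancel₀ _ hAL
  have h2 : e₁ / A * (r + s * ω) = e₂ := by
    field_simp
    apply mul_left_cancel₀ hgL
    apply mul_left_cancel₀ hdL
    linear_combination (-e₁ * d) * hrs + d * e₂ * hA' - d ^ 2 * hxy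
  rcases lt_or_gt_of_ne hs0 with hneg | hpos
  · obtain ⟨ℓ, hℓ⟩ := Int.eq_ofNat_of_zero_le (a := -s) (by omega)
    obtain rfl : s = -(ℓ : ℤ) := by omega
    refine ⟨ℓ, by omega, e₁ / A, A, -r, C, u, -v, w, hc0, hA0, by rw [hAC]; ring,
      by rw [← huvw, hB2]; ring, ?_⟩
    have h3 : e₁ / A * (((-r : ℤ) : L) + ℓ * ω) = -e₂ := by
      rw [← h2]
      push_cast
      ring
    rw [h1, h3]
    exact he.neg_right
  · obtain ⟨ℓ, rfl⟩ := Int.eq_ofNat_of_zero_le hpos.le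
    refine ⟨ℓ, by omega, e₁ / A, A, r, C, u, v, w, hc0, hA0, hAC, by rw [← huvw, hB2], ?_⟩
    rw [h1]
    rw [Int.cast_natCast] at h2
    rwa [h2]

theorem IsLatticeBasis.left_mem {M : Set L} {e₁ e₂ : L} (h : IsLatticeBasis M e₁ e₂) : e₁ ∈ M :=
  (h.mem_iff _).2 ⟨1, 0, by simp⟩

theorem IsLatticeBasis.right_mem {M : Set L} {e₁ e₂ : L} (h : IsLatticeBasis M e₁ e₂) : e₂ ∈ M :=
  (h.mem_iff _).2 ⟨0, 1, by simp⟩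

theorem IsLatticeBasis.add_mem {M : Set L} {e₁ e₂ : L} (h : IsLatticeBasis M e₁ e₂) {x y : L}
    (hx : x ∈ M) (hy : y ∈ M) : x + y ∈ M := by
  obtain ⟨p, q, rfl⟩ := (h.mem_iff _).1 hx
  obtain ⟨r, s, rfl⟩ := (h.mem_iff _).1 hy
  exact (h.mem_iff _).2 ⟨p + r, q + s, by push_cast; ring⟩

theorem IsLatticeBasis.ext {M : Set L} {e₁ e₂ : L} (h : IsLatticeBasis M e₁ e₂) {p q r s : ℤ}
    (heq : (p : L) * e₁ + q * e₂ = r * e₁ + s * e₂) : p = r ∧ q = s := by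
  have := h.indep (p - r) (q - s) (by push_cast; linear_combination heq)
  omega

theorem IsPrimitiveLattice.smul_mem (h : IsQuadGen ω t n) {ℓ : ℕ} {M : Set L}
    (hM : IsPrimitiveLattice ω t n ℓ M) {x y : L} (hx : x ∈ orderSubring L ℓ) (hy : y ∈ M) :
    x * y ∈ M := by
  obtain ⟨c, A, r, C, u, v, w, hc, hA, hAC, huvw, hb⟩ := hM
  obtain ⟨a, b, rfl⟩ := (h.mem_order ℓ x).1 hx
  obtain ⟨p, q, rfl⟩ := (hb.mem_iff y).1 hy
  have hACL : (A : L) * C = r ^ 2 + r * ℓ * t + ℓ ^ 2 * n := by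
    exact_mod_cast congrArg (Int.cast (R := L)) hAC
  refine (hb.mem_iff _).2
    ⟨a * p - b * r * p - b * q * C, a * q + b * A * p + b * q * (r + ℓ * t), ?_⟩
  push_cast
  linear_combination b * q * c * ℓ ^ 2 * h.sq + b * q * c * hACL

theorem IsPrimitiveLattice.exists_dual (h : IsQuadGen ω t n) {ℓ : ℕ} {M : Set L}
    (hM : IsPrimitiveLattice ω t n ℓ M) : ∃ e₁ ∈ M, ∃ e₂ ∈ M, ∃ φ₁ φ₂ : L,
      e₁ * φ₁ + e₂ * φ₂ = 1 ∧ (∀ y ∈ M, φ₁ * y ∈ orderSubring L ℓ) ∧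
        ∀ y ∈ M, φ₂ * y ∈ orderSubring L ℓ := by
  have := h.charZero
  obtain ⟨c, A, r, C, u, v, w, hc, hA, hAC, huvw, hb⟩ := hM
  have hAL : (A : L) ≠ 0 := by exact_mod_cast hA
  have hACL : (A : L) * C = r ^ 2 + r * ℓ * t + ℓ ^ 2 * n := by
    exact_mod_cast congrArg (Int.cast (R := L)) hAC
  have huL : (u : L) * A + v * (2 * r + ℓ * t) + w * C = 1 := by
    exact_mod_cast congrArg (Int.cast (R := L)) huvw
  refine ⟨_, hb.left_mem, _, hb.right_mem, (u - v * ((-r - ℓ * t + ℓ * ω) / A)) / c,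
    (v - w * ((-r - ℓ * t + ℓ * ω) / A)) / c, ?_, ?_, ?_⟩
  · field_simp
    linear_combination A * huL - w * hACL - w * ℓ ^ 2 * h.sq
  · intro y hy
    obtain ⟨p, q, rfl⟩ := (hb.mem_iff y).1 hy
    refine (h.mem_order _ _).2 ⟨u * p * A + u * q * r + v * p * (r + ℓ * t) + v * q * C,
      u * q - v * p, ?_⟩
    push_cast
    field_simp
    linear_combination - v * q * hACL - v * q * ℓ ^ 2 * h.sq
  · intro y hy
    obtain ⟨p, q, rfl⟩ := (hb.mem_iff y).1 hy
    refine (h.mem_order _ _).2 ⟨v * p * A + v * q * r + w * p * (r + ℓ * t) + w * q * C,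
      v * q - w * p, ?_⟩
    push_cast
    field_simp
    linear_combination - w * q * hACL - w * q * ℓ ^ 2 * h.sq

theorem IsPrimitiveLattice.mem_order_iff (h : IsQuadGen ω t n) {ℓ : ℕ} {M : Set L}
    (hM : IsPrimitiveLattice ω t n ℓ M) (x : L) :
    x ∈ orderSubring L ℓ ↔ ∀ y ∈ M, x * y ∈ M := by
  refine ⟨fun hx y hy => hM.smul_mem h hx hy, fun hx => ?_⟩
  obtain ⟨e₁, h₁, e₂, h₂, φ₁, φ₂, hφ, hφ₁, hφ₂⟩ := hM.exists_dual h
  have : x = φ₁ * (x * e₁) + φ₂ * (x * e₂) := by linear_combination -x * hφ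
  rw [this]
  exact Subring.add_mem _ (hφ₁ _ (hx _ h₁)) (hφ₂ _ (hx _ h₂))

theorem IsQuadGen.dvd_of_mem_order (h : IsQuadGen ω t n) {ℓ m : ℕ}
    (hm : (m : L) * ω ∈ orderSubring L ℓ) : ℓ ∣ m := by
  obtain ⟨a, b, hab⟩ := (h.mem_order _ _).1 hm
  have := (h.indep a (b * ℓ - m) (by push_cast; linear_combination -hab)).2
  exact Int.natCast_dvd_natCast.1 ⟨b, by linarith⟩

theorem IsQuadGen.mul_mem_order (h : IsQuadGen ω t n) {ℓ g : ℕ} {x : L}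
    (hx : x ∈ orderSubring L ℓ) : (g : L) * x ∈ orderSubring L (g * ℓ) := by
  obtain ⟨a, b, rfl⟩ := (h.mem_order _ _).1 hx
  exact (h.mem_order _ _).2 ⟨g * a, b, by push_cast; ring⟩

theorem IsQuadGen.exists_of_mem_order_mul (h : IsQuadGen ω t n) {ℓ g : ℕ} {x : L}
    (hx : x ∈ orderSubring L (g * ℓ)) : ∃ k : ℤ, ∃ y ∈ orderSubring L ℓ, x = k + g * y := by
  obtain ⟨a, b, rfl⟩ := (h.mem_order _ _).1 hx
  exact ⟨a, b * (ℓ * ω), (h.mem_order _ _).2 ⟨0, b, by simp⟩, by push_cast; ring⟩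

theorem IsQuadGen.intCast_zmod_eq_zero (h : IsQuadGen ω t n) {ℓ g : ℕ} {k : ℤ} {y : L}
    (hy : y ∈ orderSubring L ℓ) (hk : (k : L) = g * y) : (k : ZMod g) = 0 := by
  obtain ⟨a, b, rfl⟩ := (h.mem_order _ _).1 hy
  have := (h.indep (k - g * a) (-(g * b * ℓ)) (by push_cast; linear_combination hk)).1
  rw [ZMod.intCast_zmod_eq_zero_iff_dvd]
  exact ⟨a, by linarith⟩

/-- `a, b` generate the lattice `M` over the order of conductor `f`. -/
def IsGenPair (f : ℕ) (M : Set L) (a b : L) : Prop :=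
  ∀ z, z ∈ M ↔ ∃ x ∈ orderSubring L f, ∃ y ∈ orderSubring L f, z = x * a + y * b

/-- The determinant of `a, b` in some `ℤ`-basis of `M` is congruent to `u` modulo `g`. -/
def HasDetMod (g : ℕ) (M : Set L) (a b : L) (u : ZMod g) : Prop :=
  ∃ e₁ e₂, IsLatticeBasis M e₁ e₂ ∧ ∃ p q r s : ℤ, a = p * e₁ + q * e₂ ∧ b = r * e₁ + s * e₂ ∧
    ((p * s - q * r : ℤ) : ZMod g) = u

theorem IsGenPair.left_mem {f : ℕ} {M : Set L} {a b : L} (h : IsGenPair f M a b) : a ∈ M :=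
  (h a).2 ⟨1, Subring.one_mem _, 0, Subring.zero_mem _, by simp⟩

theorem IsGenPair.right_mem {f : ℕ} {M : Set L} {a b : L} (h : IsGenPair f M a b) : b ∈ M :=
  (h b).2 ⟨0, Subring.zero_mem _, 1, Subring.one_mem _, by simp⟩

theorem HasDetMod.eq_or_eq_neg {g : ℕ} {M : Set L} {a b : L} {u u' : ZMod g}
    (h : HasDetMod g M a b u) (h' : HasDetMod g M a b u') : u' = u ∨ u' = -u := by
  obtain ⟨e₁, e₂, he, p, q, r, s, rfl, rfl, rfl⟩ := h
  obtain ⟨d₁, d₂, hd, p', q', r', s', ha, hb, rfl⟩ := h'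
  obtain ⟨α, β, hα⟩ := (he.mem_iff _).1 hd.left_mem
  obtain ⟨γ, δ, hγ⟩ := (he.mem_iff _).1 hd.right_mem
  obtain ⟨α', β', hα'⟩ := (hd.mem_iff _).1 he.left_mem
  obtain ⟨γ', δ', hγ'⟩ := (hd.mem_iff _).1 he.right_mem
  have h1 := he.ext (p := p) (q := q) (r := p' * α + q' * γ) (s := p' * β + q' * δ) (by
    push_cast
    rw [ha, hα, hγ]
    ring)
  have h2 := he.ext (p := r) (q := s) (r := r' * α + s' * γ) (s := r' * β + s' * δ) (by
    push_cast
    rw [hb, hα, hγ]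
    ring)
  have h3 := he.ext (p := 1) (q := 0) (r := α' * α + β' * γ) (s := α' * β + β' * δ) (by
    push_cast
    linear_combination hα' + α' * hα + β' * hγ)
  have h4 := he.ext (p := 0) (q := 1) (r := γ' * α + δ' * γ) (s := γ' * β + δ' * δ) (by
    push_cast
    linear_combination hγ' + γ' * hα + δ' * hγ)
  have hunit : (α * δ - β * γ) * (α' * δ' - β' * γ') = 1 := by
    linear_combination -(h3.1 * (γ' * β + δ' * δ)) + h3.2 * (γ' * α + δ' * γ) - h4.2
  have hdet : p * s - q * r = (p' * s' - q' * r') * (α * δ - β * γ) := by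
    rw [h1.1, h1.2, h2.1, h2.2]
    ring
  rw [hdet]
  rcases Int.isUnit_iff.1 (IsUnit.of_mul_eq_one _ hunit) with h5 | h5 <;> rw [h5] <;> simp

theorem IsLatticeBasis.scale {M M' : Set L} {c : L} (hc : c ≠ 0)
    (hM : ∀ z, z ∈ M' ↔ ∃ y ∈ M, z = c * y) {e₁ e₂ : L} (he : IsLatticeBasis M e₁ e₂) :
    IsLatticeBasis M' (c * e₁) (c * e₂) := by
  refine ⟨fun z => (hM z).trans ⟨?_, ?_⟩, fun p q hpq => he.indep p q (mul_left_cancel₀ hc ?_)⟩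
  · rintro ⟨y, hy, rfl⟩
    obtain ⟨p, q, rfl⟩ := (he.mem_iff y).1 hy
    exact ⟨p, q, by ring⟩
  · rintro ⟨p, q, rfl⟩
    exact ⟨p * e₁ + q * e₂, (he.mem_iff _).2 ⟨p, q, rfl⟩, by ring⟩
  · linear_combination hpq

theorem HasDetMod.scale {g : ℕ} {M M' : Set L} {c : L} (hc : c ≠ 0)
    (hM : ∀ z, z ∈ M' ↔ ∃ y ∈ M, z = c * y) {a b : L} {u : ZMod g} (h : HasDetMod g M a b u) :
    HasDetMod g M' (c * a) (c * b) u := by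
  obtain ⟨e₁, e₂, he, p, q, r, s, rfl, rfl, rfl⟩ := h
  exact ⟨_, _, he.scale hc hM, p, q, r, s, by ring, by ring, rfl⟩

theorem IsGenPair.scale {f : ℕ} {M M' : Set L} {c : L}
    (hM : ∀ z, z ∈ M' ↔ ∃ y ∈ M, z = c * y) {a b : L} (h : IsGenPair f M a b) :
    IsGenPair f M' (c * a) (c * b) := by
  refine fun z => (hM z).trans ⟨?_, ?_⟩
  · rintro ⟨w, hw, rfl⟩
    obtain ⟨x, hx, y, hy, rfl⟩ := (h w).1 hw
    exact ⟨x, hx, y, hy, by ring⟩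
  · rintro ⟨x, hx, y, hy, rfl⟩
    exact ⟨_, (h _).2 ⟨x, hx, y, hy, rfl⟩, by ring⟩

theorem IsGenPair.transform {f : ℕ} {M : Set L} {a b x y z w d : L} (h : IsGenPair f M a b)
    (hx : x ∈ orderSubring L f) (hy : y ∈ orderSubring L f) (hz : z ∈ orderSubring L f)
    (hw : w ∈ orderSubring L f) (hd : d ∈ orderSubring L f) (hdet : (x * w - y * z) * d = 1) :
    IsGenPair f M (x * a + y * b) (z * a + w * b) := by
  refine fun m => (h m).trans ⟨?_, ?_⟩
  · rintro ⟨s, hs, k, hk, rfl⟩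
    refine ⟨d * (s * w - k * z), mul_mem hd (sub_mem (mul_mem hs hw) (mul_mem hk hz)),
      d * (k * x - s * y), mul_mem hd (sub_mem (mul_mem hk hx) (mul_mem hs hy)), ?_⟩
    linear_combination (-(s * a) - k * b) * hdet
  · rintro ⟨s, hs, k, hk, rfl⟩
    exact ⟨s * x + k * z, add_mem (mul_mem hs hx) (mul_mem hk hz), s * y + k * w,
      add_mem (mul_mem hs hy) (mul_mem hk hw), by ring⟩

theorem IsPrimitiveLattice.exists_det_transform (h : IsQuadGen ω t n) {ℓ g : ℕ} {M : Set L}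
    (hM : IsPrimitiveLattice ω t n ℓ M) {e₁ e₂ : L} (he : IsLatticeBasis M e₁ e₂)
    (p q r s : ℤ) {x y z w : L}
    (hx : x ∈ orderSubring L (g * ℓ)) (hy : y ∈ orderSubring L (g * ℓ))
    (hz : z ∈ orderSubring L (g * ℓ)) (hw : w ∈ orderSubring L (g * ℓ)) :
    ∃ N p' q' r' s' : ℤ, ∃ m ∈ orderSubring L ℓ,
      x * (p * e₁ + q * e₂) + y * (r * e₁ + s * e₂) = p' * e₁ + q' * e₂ ∧
      z * (p * e₁ + q * e₂) + w * (r * e₁ + s * e₂) = r' * e₁ + s' * e₂ ∧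
      x * w - y * z = N + g * m ∧
      ((p' * s' - q' * r' : ℤ) : ZMod g) = N * ((p * s - q * r : ℤ) : ZMod g) := by
  have ha : (p * e₁ + q * e₂ : L) ∈ M := (he.mem_iff _).2 ⟨p, q, rfl⟩
  have hb : (r * e₁ + s * e₂ : L) ∈ M := (he.mem_iff _).2 ⟨r, s, rfl⟩
  obtain ⟨x₀, x₁, hx₁, rfl⟩ := h.exists_of_mem_order_mul hx
  obtain ⟨y₀, y₁, hy₁, rfl⟩ := h.exists_of_mem_order_mul hy
  obtain ⟨z₀, z₁, hz₁, rfl⟩ := h.exists_of_mem_order_mul hz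
  obtain ⟨w₀, w₁, hw₁, rfl⟩ := h.exists_of_mem_order_mul hw
  obtain ⟨m₁, m₂, hm⟩ := (he.mem_iff _).1 (he.add_mem (hM.smul_mem h hx₁ ha) (hM.smul_mem h hy₁ hb))
  obtain ⟨k₁, k₂, hk⟩ := (he.mem_iff _).1 (he.add_mem (hM.smul_mem h hz₁ ha) (hM.smul_mem h hw₁ hb))
  refine ⟨x₀ * w₀ - y₀ * z₀, x₀ * p + y₀ * r + g * m₁, x₀ * q + y₀ * s + g * m₂,
    z₀ * p + w₀ * r + g * k₁, z₀ * q + w₀ * s + g * k₂,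
    x₀ * w₁ + x₁ * w₀ + g * (x₁ * w₁) - (y₀ * z₁ + y₁ * z₀ + g * (y₁ * z₁)), ?_, ?_, ?_, ?_, ?_⟩
  · have hi : ∀ k : ℤ, (k : L) ∈ orderSubring L ℓ := fun k => intCast_mem _ k
    have hg : (g : L) ∈ orderSubring L ℓ := natCast_mem _ g
    exact sub_mem (add_mem (add_mem (mul_mem (hi _) hw₁) (mul_mem hx₁ (hi _)))
      (mul_mem hg (mul_mem hx₁ hw₁))) (add_mem (add_mem (mul_mem (hi _) hz₁) (mul_mem hy₁ (hi _)))
      (mul_mem hg (mul_mem hy₁ hz₁)))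
  · push_cast
    linear_combination (g : L) * hm
  · push_cast
    linear_combination (g : L) * hk
  · push_cast
    ring
  · push_cast
    rw [ZMod.natCast_self]
    ring

theorem IsQuadGen.order_mul_le (h : IsQuadGen ω t n) {ℓ g : ℕ} {x : L}
    (hx : x ∈ orderSubring L (g * ℓ)) : x ∈ orderSubring L ℓ := by
  obtain ⟨k, y, hy, rfl⟩ := h.exists_of_mem_order_mul hx
  exact add_mem (intCast_mem _ k) (mul_mem (natCast_mem _ g) hy)

theorem exists_coprime_lift {g : ℕ} (hg : 0 < g) {A : ℤ} (hA : A ≠ 0) (u : (ZMod g)ˣ) :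
    ∃ k a b : ℤ, a * k + b * (g * A) = 1 ∧ (k : ZMod g) = u := by
  have : NeZero (g * A.natAbs) := ⟨mul_ne_zero hg.ne' (Int.natAbs_ne_zero.2 hA)⟩
  obtain ⟨U, rfl⟩ := ZMod.unitsMap_surjective (Dvd.intro A.natAbs rfl : g ∣ g * A.natAbs) u
  obtain ⟨a, b, hab⟩ := Nat.isCoprime_iff_coprime.2 (ZMod.val_coe_unit_coprime U)
  obtain ⟨ε, hε⟩ : ∃ ε : ℤ, (A.natAbs : ℤ) = ε * A := by
    rcases Int.natAbs_eq A with h | h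
    · exact ⟨1, by omega⟩
    · exact ⟨-1, by omega⟩
  refine ⟨(U : ZMod (g * A.natAbs)).val, a, b * ε, ?_, ?_⟩
  · rw [← hab, Nat.cast_mul, hε]
    ring
  · rw [ZMod.unitsMap_val, Int.cast_natCast, ZMod.natCast_val]

theorem IsPrimitiveLattice.exists_isGenPair (h : IsQuadGen ω t n) {ℓ g : ℕ} (hg : 0 < g)
    {M : Set L} (hM : IsPrimitiveLattice ω t n ℓ M) (u : (ZMod g)ˣ) :
    ∃ a b, IsGenPair (g * ℓ) M a b ∧ HasDetMod g M a b u := by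
  obtain ⟨c, A, r, C, _, _, _, hc, hA, -, -, hb⟩ := id hM
  obtain ⟨k, α, β, hk, hku⟩ := exists_coprime_lift hg hA u
  refine ⟨c * A, k * (c * (r + ℓ * ω)), fun z => ⟨fun hz => ?_, ?_⟩,
    _, _, hb, 1, 0, 0, k, by simp, by simp, by simpa using hku⟩
  · obtain ⟨p, q, rfl⟩ := (hb.mem_iff z).1 hz
    refine ⟨p + q * β * (g * r + g * ℓ * ω), (h.mem_order _ _).2
      ⟨p + q * β * (g * r), q * β, by push_cast; ring⟩, ((q * α : ℤ) : L), intCast_mem _ _, ?_⟩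
    have hkL : (α : L) * k + β * (g * A) = 1 := by exact_mod_cast congrArg (Int.cast (R := L)) hk
    push_cast
    linear_combination (-q * (c * (r + ℓ * ω))) * hkL
  · rintro ⟨x, hx, y, hy, rfl⟩
    exact hb.add_mem (hM.smul_mem h (h.order_mul_le hx) hb.left_mem)
      (hM.smul_mem h (h.order_mul_le hy) ((hb.mem_iff _).2 ⟨0, k, by simp⟩))

theorem IsPrimitiveLattice.exists_transform (h : IsQuadGen ω t n) {ℓ g : ℕ} {M : Set L}
    (hM : IsPrimitiveLattice ω t n ℓ M) {a b a' b' : L} {u u' : ZMod g}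
    (hab : IsGenPair (g * ℓ) M a b) (hab' : IsGenPair (g * ℓ) M a' b')
    (hd : HasDetMod g M a b u) (hd' : HasDetMod g M a' b' u') (hu : IsUnit u)
    (huu : u' = u ∨ u' = -u) :
    ∃ x ∈ orderSubring L (g * ℓ), ∃ y ∈ orderSubring L (g * ℓ), ∃ z ∈ orderSubring L (g * ℓ),
      ∃ w ∈ orderSubring L (g * ℓ), (x * w - y * z = 1 ∨ x * w - y * z = -1) ∧
        a' = x * a + y * b ∧ b' = z * a + w * b := by
  obtain ⟨e₁, e₂, he, p, q, r, s, rfl, rfl, rfl⟩ := hd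
  obtain ⟨x, hx, y, hy, ha⟩ := (hab _).1 hab'.left_mem
  obtain ⟨z, hz, w, hw, hb⟩ := (hab _).1 hab'.right_mem
  obtain ⟨N, p', q', r', s', m, hm, h1, h2, hdet, hN⟩ :=
    hM.exists_det_transform h he p q r s hx hy hz hw
  have hd'' : HasDetMod g M a' b' ((p' * s' - q' * r' : ℤ) : ZMod g) :=
    ⟨e₁, e₂, he, p', q', r', s', ha.trans h1, hb.trans h2, rfl⟩
  obtain ⟨ε, hε, hNε⟩ : ∃ ε : ℤ, (ε = 1 ∨ ε = -1) ∧ (N : ZMod g) = ε := by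
    have hN' : (N : ZMod g) * ((p * s - q * r : ℤ) : ZMod g) = 1 * ((p * s - q * r : ℤ) : ZMod g) ∨
        (N : ZMod g) * ((p * s - q * r : ℤ) : ZMod g) =
          -1 * ((p * s - q * r : ℤ) : ZMod g) := by
      rw [← hN, one_mul, neg_one_mul]
      rcases hd'.eq_or_eq_neg hd'' with h3 | h3 <;> rcases huu with h4 | h4 <;> rw [h3, h4] <;> simp
    rcases hN' with h3 | h3
    · exact ⟨1, Or.inl rfl, by simpa using hu.mul_right_cancel h3⟩
    · exact ⟨-1, Or.inr rfl, by simpa using hu.mul_right_cancel h3⟩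
  obtain ⟨k, hk⟩ : (g : ℤ) ∣ N - ε := by
    rw [← ZMod.intCast_zmod_eq_zero_iff_dvd]
    push_cast
    rw [hNε, sub_self]
  have hkL : (N : L) - ε = g * k := by exact_mod_cast congrArg (Int.cast (R := L)) hk
  obtain ⟨d₁, hd₁, d₂, hd₂, φ₁, φ₂, hφ, hφ₁, hφ₂⟩ := hM.exists_dual h
  obtain ⟨x₁, hx₁, y₁, hy₁, rfl⟩ := (hab' _).1 hd₁
  obtain ⟨x₂, hx₂, y₂, hy₂, rfl⟩ := (hab' _).1 hd₂
  have hψ : ∀ x₁ ∈ orderSubring L (g * ℓ), ∀ x₂ ∈ orderSubring L (g * ℓ), ∀ c ∈ M,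
      g * ((k + m) * (x₁ * (φ₁ * c) + x₂ * (φ₂ * c))) ∈ orderSubring L (g * ℓ) :=
    fun x₁ hx₁ x₂ hx₂ c hc => h.mul_mem_order (mul_mem (add_mem (intCast_mem _ k) hm)
      (add_mem (mul_mem (h.order_mul_le hx₁) (hφ₁ c hc))
        (mul_mem (h.order_mul_le hx₂) (hφ₂ c hc))))
  refine ⟨_, sub_mem hx (hψ y₁ hy₁ y₂ hy₂ _ hab.right_mem),
    _, add_mem hy (hψ y₁ hy₁ y₂ hy₂ _ hab.left_mem),
    _, add_mem hz (hψ x₁ hx₁ x₂ hx₂ _ hab.right_mem),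
    _, sub_mem hw (hψ x₁ hx₁ x₂ hx₂ _ hab.left_mem), ?_, ?_, ?_⟩
  · suffices hs : ∀ D : L, D = ε → D = 1 ∨ D = -1 by
      apply hs
      rw [ha, hb] at hφ
      generalize (p * e₁ + q * e₂ : L) = a at *
      generalize (r * e₁ + s * e₂ : L) = b at *
      linear_combination hdet + hkL - g * (k + m) * hφ
    rintro D rfl
    rcases hε with rfl | rfl <;> simp
  · rw [ha]
    ring
  · rw [hb]
    ring

theorem IsPrimitiveLattice.exists_bounded (h : IsQuadGen ω t n) {ℓ : ℕ} (hℓ : 0 < ℓ) :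
    ∃ B : ℤ, ∀ M : Set L, IsPrimitiveLattice ω t n ℓ M → ∃ (c : L) (A r : ℤ), c ≠ 0 ∧ |A| ≤ B ∧
      |r| ≤ B ∧ IsLatticeBasis M (c * A) (c * (r + ℓ * ω)) := by
  have := h.charZero
  refine ⟨ℓ ^ 2 * |t ^ 2 - 4 * n| + ℓ * |t|, fun M hM => ?_⟩
  obtain ⟨c, A, r, C, -, -, -, hc, hA, hAC, -, hb⟩ := hM
  obtain ⟨N, hN⟩ : ∃ N : ℕ, A.natAbs = N := ⟨_, rfl⟩
  induction N using Nat.strong_induction_on generalizing c A r C with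
  | _ N ih =>
  obtain ⟨k, hk⟩ : ∃ k : ℤ, |2 * (r - A * k) + ℓ * t| ≤ |A| := by
    refine ⟨(2 * r + ℓ * t + |A|) / (2 * A), ?_⟩
    have h1 := Int.mul_ediv_add_emod (2 * r + ℓ * t + |A|) (2 * A)
    have h2 := Int.emod_nonneg (2 * r + ℓ * t + |A|) (b := 2 * A) (by omega)
    have h3 := Int.emod_lt_abs (2 * r + ℓ * t + |A|) (b := 2 * A) (by omega)
    rw [abs_mul, abs_two] at h3
    rw [abs_le]
    constructor <;> linarith
  obtain ⟨r', hr'⟩ : ∃ r', r' = r - A * k := ⟨_, rfl⟩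
  obtain ⟨C', hC'⟩ : ∃ C', C' = C - 2 * k * r + A * k ^ 2 - k * ℓ * t := ⟨_, rfl⟩
  have hAC' : A * C' = r' ^ 2 + r' * ℓ * t + ℓ ^ 2 * n := by
    rw [hC', hr']
    linear_combination hAC
  rw [← hr'] at hk
  have hb' : IsLatticeBasis M (c * A) (c * (r' + ℓ * ω)) := by
    refine ⟨fun z => (hb.mem_iff z).trans ⟨?_, ?_⟩, fun p q hpq => ?_⟩
    · rintro ⟨p, q, rfl⟩
      exact ⟨p + q * k, q, by rw [hr']; push_cast; ring⟩
    · rintro ⟨p, q, rfl⟩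
      exact ⟨p - q * k, q, by rw [hr']; push_cast; ring⟩
    · obtain ⟨h1, rfl⟩ := hb.indep (p - q * k) q (by rw [← hpq, hr']; push_cast; ring)
      exact ⟨by simpa using h1, rfl⟩
  have hα : (r' + ℓ * ω : L) ≠ 0 := fun h0 => by
    have := (h.indep r' ℓ (by exact_mod_cast h0)).2
    omega
  have hα' : (r' + ℓ * t - ℓ * ω : L) ≠ 0 := fun h0 => by
    have := (h.indep (r' + ℓ * t) (-ℓ) (by push_cast; linear_combination h0)).2
    omega
  have hnorm : (A : L) * C' = (r' + ℓ * ω) * (r' + ℓ * t - ℓ * ω) := by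
    have : (A : L) * C' = r' ^ 2 + r' * ℓ * t + ℓ ^ 2 * n := by
      exact_mod_cast congrArg (Int.cast (R := L)) hAC'
    linear_combination this + ℓ ^ 2 * h.sq
  have hC0 : (C' : L) ≠ 0 := fun h0 => by
    rw [h0, mul_zero] at hnorm
    exact mul_ne_zero hα hα' hnorm.symm
  rcases lt_or_ge |C'| |A| with hlt | hge
  · refine ih C'.natAbs (hN ▸ Int.natAbs_lt_iff_sq_lt.2 (sq_lt_sq.2 hlt))
      (c * (r' + ℓ * ω) / C') C' (-r' - ℓ * t) A
      (div_ne_zero (mul_ne_zero hc hα) hC0) (by exact_mod_cast hC0)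
      (by linear_combination hAC') ?_ rfl
    have h1 : c * (r' + ℓ * ω) / C' * C' = c * (r' + ℓ * ω) := div_mul_cancel₀ _ hC0
    have h2 : c * (r' + ℓ * ω) / C' * (((-r' - ℓ * t : ℤ) : L) + ℓ * ω) = -(c * A) := by
      field_simp
      push_cast
      linear_combination hnorm
    rw [h1, h2]
    refine IsLatticeBasis.neg_right ⟨fun z => (hb'.mem_iff z).trans ⟨?_, ?_⟩, fun p q hpq => ?_⟩
    · rintro ⟨p, q, rfl⟩
      exact ⟨q, p, add_comm _ _⟩
    · rintro ⟨p, q, rfl⟩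
      exact ⟨q, p, add_comm _ _⟩
    · exact (hb'.indep q p (by rw [← hpq, add_comm])).symm
  · refine ⟨c, A, r', hc, ?_, ?_, hb'⟩
    all_goals
      have h4 : 4 * (A * C') = (2 * r' + ℓ * t) ^ 2 - ℓ ^ 2 * (t ^ 2 - 4 * n) := by
        rw [hAC']
        ring
      have h5 : 4 * (|A| * |C'|) ≤ |A| ^ 2 + ℓ ^ 2 * |t ^ 2 - 4 * n| := by
        calc 4 * (|A| * |C'|) = |4 * (A * C')| := by rw [abs_mul 4, abs_mul A]; rfl
          _ ≤ |(2 * r' + ℓ * t) ^ 2| + |ℓ ^ 2 * (t ^ 2 - 4 * n)| := by rw [h4]; exact abs_sub _ _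
          _ = |2 * r' + ℓ * t| ^ 2 + ℓ ^ 2 * |t ^ 2 - 4 * n| := by
            rw [abs_mul, abs_pow, abs_pow, Nat.abs_cast]
          _ ≤ _ := by gcongr
      have h6 : 0 < |A| := abs_pos.2 hA
      have h7 : 0 ≤ ℓ * |t| := by positivity
      have h8 : |A| ≤ ℓ ^ 2 * |t ^ 2 - 4 * n| := by nlinarith
    · linarith
    · have h9 : |2 * r'| ≤ |2 * r' + ℓ * t| + |ℓ * t| := by
        simpa using abs_sub (2 * r' + ℓ * t) (ℓ * t)
      rw [abs_mul, abs_mul, Nat.abs_cast, abs_two] at h9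
      linarith [abs_nonneg r']

end Lattice

theorem exists_lattice_of_pair (hdeg : Module.finrank ℚ K = 2) {ω : K} {t n : ℤ}
    (h : IsQuadGen ω t n) {f : ℕ} (hf : 0 < f) {a b : K} (hab : ¬(a = 0 ∧ b = 0)) :
    ∃ (ℓ g : ℕ) (M : Set K) (u : (ZMod g)ˣ), f = g * ℓ ∧ IsPrimitiveLattice ω t n ℓ M ∧
      IsGenPair f M a b ∧ HasDetMod g M a b u := by
  let M : Submodule ℤ K := Submodule.span ℤ {a, f * ω * a, b, f * ω * b}
  have hgen : IsGenPair f (M : Set K) a b := by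
    intro z
    simp only [M, SetLike.mem_coe, Submodule.mem_span_insert, Submodule.mem_span_singleton,
      zsmul_eq_mul]
    constructor
    · rintro ⟨p, _, ⟨q, _, ⟨r, _, ⟨s, rfl⟩, rfl⟩, rfl⟩, rfl⟩
      exact ⟨p + q * (f * ω), (h.mem_order _ _).2 ⟨p, q, rfl⟩, r + s * (f * ω),
        (h.mem_order _ _).2 ⟨r, s, rfl⟩, by ring⟩
    · rintro ⟨x, hx, y, hy, rfl⟩
      obtain ⟨p, q, rfl⟩ := (h.mem_order _ _).1 hx
      obtain ⟨r, s, rfl⟩ := (h.mem_order _ _).1 hy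
      exact ⟨p, _, ⟨q, _, ⟨r, _, ⟨s, rfl⟩, rfl⟩, rfl⟩, by ring⟩
  have hω : (f : K) * ω ∈ orderSubring K f := (h.mem_order _ _).2 ⟨0, 1, by simp⟩
  have hωM : ∀ y ∈ (M : Set K), f * ω * y ∈ (M : Set K) := by
    intro y hy
    obtain ⟨x, hx, z, hz, rfl⟩ := (hgen y).1 hy
    exact (hgen _).2 ⟨_, mul_mem hω hx, _, mul_mem hω hz, by ring⟩
  obtain ⟨x, hx0, hx⟩ : ∃ x : K, x ≠ 0 ∧ x ∈ M := by
    by_cases ha : a = 0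
    · exact ⟨b, fun hb => hab ⟨ha, hb⟩, hgen.right_mem⟩
    · exact ⟨a, ha, hgen.left_mem⟩
  obtain ⟨e₁, e₂, he⟩ := exists_isLatticeBasis hdeg h M (Submodule.fg_span (by simp)) hx0 hx
    (k := f) (by omega) (by simpa using hωM x hx)
  obtain ⟨ℓ, hℓ, hM⟩ := he.isPrimitiveLattice h
  obtain ⟨g, rfl⟩ := h.dvd_of_mem_order ((hM.mem_order_iff h _).2 hωM)
  rw [mul_comm ℓ g] at hgen
  obtain ⟨p, q, ha⟩ := (he.mem_iff _).1 hgen.left_mem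
  obtain ⟨r, s, hb⟩ := (he.mem_iff _).1 hgen.right_mem
  obtain ⟨x, hx, y, hy, h1⟩ := (hgen _).1 he.left_mem
  obtain ⟨z, hz, w, hw, h2⟩ := (hgen _).1 he.right_mem
  obtain ⟨N, p', q', r', s', m, -, h3, h4, -, hN⟩ :=
    hM.exists_det_transform h he p q r s hx hy hz hw
  rw [← ha, ← hb, ← h1] at h3
  rw [← ha, ← hb, ← h2] at h4
  have h5 := he.ext (p := 1) (q := 0) (by simpa using h3)
  have h6 := he.ext (p := 0) (q := 1) (by simpa using h4)
  rw [← h5.1, ← h5.2, ← h6.1, ← h6.2] at hN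
  obtain ⟨u, hu⟩ := IsUnit.of_mul_eq_one (N : ZMod g)
    ((mul_comm _ _).trans (hN.symm.trans (by simp)))
  exact ⟨ℓ, g, M, u, mul_comm _ _, hM, by rwa [mul_comm], e₁, e₂, he, p, q, r, s, ha, hb, hu.symm⟩

section ClassGroup

open nonZeroDivisors FractionalIdeal

variable {ω : K} {t n : ℤ} {ℓ : ℕ}

theorem IsQuadGen.isFractionRing (h : IsQuadGen ω t n) (hℓ : 0 < ℓ) :
    IsFractionRing (orderSubring K ℓ) K := by
  refine IsFractionRing.of_field _ _ fun z => ?_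
  obtain ⟨a, b, d, hd, hz⟩ := h.frac z
  refine ⟨⟨ℓ * a + b * (ℓ * ω), (h.mem_order _ _).2 ⟨ℓ * a, b, by push_cast; ring⟩⟩,
    ⟨ℓ * d, (h.mem_order _ _).2 ⟨ℓ * d, 0, by push_cast; ring⟩⟩, ?_⟩
  have hd' : (d : K) ≠ 0 := by exact_mod_cast hd
  have hℓ' : (ℓ : K) ≠ 0 := by exact_mod_cast hℓ.ne'
  change z = (ℓ * a + b * (ℓ * ω)) / (ℓ * d)
  rw [eq_div_iff (mul_ne_zero hℓ' hd')]
  linear_combination ℓ * hz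

theorem IsQuadGen.finite_order {L : Type} [Field L] {ω : L} {t n : ℤ} (h : IsQuadGen ω t n)
    (ℓ : ℕ) : Module.Finite ℤ (orderSubring L ℓ) := by
  let α : orderSubring L ℓ := ⟨ℓ * ω, (h.mem_order _ _).2 ⟨0, 1, by simp⟩⟩
  have hα : Submodule.span ℤ {1, α} = ⊤ := eq_top_iff.2 fun x _ => by
    obtain ⟨a, b, hab⟩ := (h.mem_order _ _).1 x.2
    simp only [Submodule.mem_span_insert, Submodule.mem_span_singleton]
    exact ⟨a, _, ⟨b, rfl⟩, Subtype.ext (by simpa [α] using hab)⟩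
  exact ⟨hα ▸ Submodule.fg_span (Set.toFinite _)⟩

theorem IsQuadGen.isPrimitiveLattice_fractionalIdeal (hdeg : Module.finrank ℚ K = 2)
    (h : IsQuadGen ω t n) (hℓ : 0 < ℓ) (I : (FractionalIdeal (orderSubring K ℓ)⁰ K)ˣ) :
    IsPrimitiveLattice ω t n ℓ {x | x ∈ (I : FractionalIdeal (orderSubring K ℓ)⁰ K)} := by
  have := h.isFractionRing hℓ
  have := h.finite_order ℓ
  let N : Submodule (orderSubring K ℓ) K := ((I : FractionalIdeal (orderSubring K ℓ)⁰ K) : _)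
  have hN : Module.Finite (orderSubring K ℓ) N := Module.Finite.iff_fg.2 (fg_unit I)
  have hNZ : (N.restrictScalars ℤ).FG :=
    Module.Finite.iff_fg.1 (Module.Finite.trans (R := ℤ) (orderSubring K ℓ) N)
  have hsmul : ∀ x ∈ orderSubring K ℓ, ∀ y ∈ N, x * y ∈ N := fun x hx y hy =>
    N.smul_mem ⟨x, hx⟩ hy
  have hω : (ℓ : K) * ω ∈ orderSubring K ℓ := (h.mem_order _ _).2 ⟨0, 1, by simp⟩
  obtain ⟨x, hx, hx0⟩ : ∃ x ∈ N, x ≠ 0 := by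
    refine N.ne_bot_iff.1 fun h0 => I.ne_zero ?_
    exact coeToSubmodule_eq_bot.1 h0
  obtain ⟨e₁, e₂, he⟩ := exists_isLatticeBasis hdeg h (N.restrictScalars ℤ) hNZ hx0 hx (k := ℓ)
    (by omega) (by simpa using hsmul _ hω x hx)
  obtain ⟨ℓ', hℓ', hM⟩ := he.isPrimitiveLattice h
  have hmul : ∀ x, (∀ y ∈ N, x * y ∈ N) → x ∈ orderSubring K ℓ := by
    intro x hx
    have h1 : spanSingleton (orderSubring K ℓ)⁰ x * I ≤ I := by
      rw [spanSingleton_mul_le_iff]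
      exact hx
    have h2 := mul_le_mul_left h1 ((I⁻¹ : (FractionalIdeal (orderSubring K ℓ)⁰ K)ˣ) :
      FractionalIdeal (orderSubring K ℓ)⁰ K)
    rw [mul_assoc, I.mul_inv, mul_one, spanSingleton_le_iff_mem, mem_one_iff] at h2
    obtain ⟨y, rfl⟩ := h2
    exact y.2
  obtain rfl : ℓ = ℓ' := by
    refine Nat.dvd_antisymm (h.dvd_of_mem_order (hmul _ fun y hy => ?_))
      (h.dvd_of_mem_order ((hM.mem_order_iff h _).2 fun y hy => hsmul _ hω y hy))
    exact hM.smul_mem h ((h.mem_order _ _).2 ⟨0, 1, by simp⟩) hy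
  exact hM

theorem IsPrimitiveLattice.exists_fractionalIdeal (h : IsQuadGen ω t n) (hℓ : 0 < ℓ)
    {M : Set K} (hM : IsPrimitiveLattice ω t n ℓ M) :
    ∃ I : (FractionalIdeal (orderSubring K ℓ)⁰ K)ˣ,
      {x | x ∈ (I : FractionalIdeal (orderSubring K ℓ)⁰ K)} = M := by
  have := h.isFractionRing hℓ
  obtain ⟨e₁, h₁, e₂, h₂, φ₁, φ₂, hφ, hφ₁, hφ₂⟩ := hM.exists_dual h
  obtain ⟨_, _, hb⟩ : ∃ e₁ e₂, IsLatticeBasis M e₁ e₂ := by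
    obtain ⟨_, _, _, _, _, _, _, _, _, _, _, hb⟩ := id hM
    exact ⟨_, _, hb⟩
  have hmem : ∀ a b z : K, z ∈ spanSingleton (orderSubring K ℓ)⁰ a +
      spanSingleton (orderSubring K ℓ)⁰ b ↔
        ∃ x ∈ orderSubring K ℓ, ∃ y ∈ orderSubring K ℓ, z = x * a + y * b := by
    intro a b z
    simp only [mem_add, mem_spanSingleton]
    constructor
    · rintro ⟨_, ⟨x, rfl⟩, _, ⟨y, rfl⟩, rfl⟩
      exact ⟨x, x.2, y, y.2, rfl⟩
    · rintro ⟨x, hx, y, hy, rfl⟩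
      exact ⟨_, ⟨⟨x, hx⟩, rfl⟩, _, ⟨⟨y, hy⟩, rfl⟩, rfl⟩
  let I := spanSingleton (orderSubring K ℓ)⁰ e₁ + spanSingleton (orderSubring K ℓ)⁰ e₂
  let J := spanSingleton (orderSubring K ℓ)⁰ φ₁ + spanSingleton (orderSubring K ℓ)⁰ φ₂
  have hI : {x | x ∈ I} = M := by
    ext z
    refine (hmem _ _ z).trans ⟨?_, fun hz => ?_⟩
    · rintro ⟨x, hx, y, hy, rfl⟩
      exact hb.add_mem (hM.smul_mem h hx h₁) (hM.smul_mem h hy h₂)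
    · exact ⟨φ₁ * z, hφ₁ z hz, φ₂ * z, hφ₂ z hz, by linear_combination -z * hφ⟩
  have hIJ : I * J = 1 := by
    refine le_antisymm (mul_le.2 fun i hi j hj => ?_) ?_
    · obtain ⟨x, hx, y, hy, rfl⟩ := (hmem _ _ j).1 hj
      have hiM : i ∈ M := hI ▸ hi
      refine (mem_one_iff _).2 ⟨⟨_, add_mem (mul_mem hx (hφ₁ i hiM)) (mul_mem hy (hφ₂ i hiM))⟩, ?_⟩
      change x * (φ₁ * i) + y * (φ₂ * i) = _
      ring
    · rw [FractionalIdeal.one_le, ← hφ]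
      exact Submodule.add_mem (I * J).coeToSubmodule
        (mul_mem_mul ((hmem _ _ _).2 ⟨1, one_mem _, 0, zero_mem _, by simp⟩)
        ((hmem _ _ _).2 ⟨1, one_mem _, 0, zero_mem _, by simp⟩))
        (mul_mem_mul ((hmem _ _ _).2 ⟨0, zero_mem _, 1, one_mem _, by simp⟩)
        ((hmem _ _ _).2 ⟨0, zero_mem _, 1, one_mem _, by simp⟩))
  exact ⟨Units.mkOfMulEqOne I J hIJ, hI⟩

theorem classGroup_mk_eq_mk_iff {R F : Type*} [CommRing R] [IsDomain R]
    [Field F] [Algebra R F] [IsFractionRing R F] (I J : (FractionalIdeal R⁰ F)ˣ) :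
    ClassGroup.mk F I = ClassGroup.mk F J ↔ ∃ c : F, c ≠ 0 ∧
      ∀ z, z ∈ (J : FractionalIdeal R⁰ F) ↔ ∃ y ∈ (I : FractionalIdeal R⁰ F), z = c * y := by
  have hid : ∀ I : (FractionalIdeal R⁰ F)ˣ,
      Units.mapEquiv (canonicalEquiv R⁰ F F).toMulEquiv I = I := fun I => Units.ext (by simp)
  have hJ : ∀ c : F, (∀ z, z ∈ (J : FractionalIdeal R⁰ F) ↔
      ∃ y ∈ (I : FractionalIdeal R⁰ F), z = c * y) ↔ (I : FractionalIdeal R⁰ F) *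
        spanSingleton R⁰ c = J := fun c => by
    rw [mul_comm, FractionalIdeal.ext_iff]
    simp only [mem_singleton_mul, iff_comm]
  rw [← (ClassGroup.equiv (R := R) F).injective.eq_iff, ClassGroup.equiv_mk,
    ClassGroup.equiv_mk, QuotientGroup.mk'_eq_mk']
  simp only [MonoidHom.mem_range, hJ]
  constructor
  · rintro ⟨_, ⟨c, rfl⟩, hc⟩
    refine ⟨c, c.ne_zero, ?_⟩
    simpa [Units.ext_iff] using hc
  · rintro ⟨c, hc0, hc⟩
    refine ⟨_, ⟨Units.mk0 c hc0, rfl⟩, ?_⟩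
    simpa [Units.ext_iff] using hc

/-- Every invertible ideal class of the order of conductor `ℓ` can be represented by a lattice,
and the lattices of conductor `ℓ` up to homothety correspond to these classes. -/
theorem IsQuadGen.exists_latticeRep (hdeg : Module.finrank ℚ K = 2) (h : IsQuadGen ω t n)
    (hℓ : 0 < ℓ) : ∃ Λ : ClassGroup (orderSubring K ℓ) → Set K,
      (∀ C, IsPrimitiveLattice ω t n ℓ (Λ C)) ∧
      (∀ M, IsPrimitiveLattice ω t n ℓ M →
        ∃ C, ∃ c : K, c ≠ 0 ∧ ∀ z, z ∈ Λ C ↔ ∃ y ∈ M, z = c * y) ∧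
      ∀ C C' (c : K), c ≠ 0 → (∀ z, z ∈ Λ C' ↔ ∃ y ∈ Λ C, z = c * y) → C = C' := by
  have := h.isFractionRing hℓ
  have hsurj : Function.Surjective (ClassGroup.mk (R := orderSubring K ℓ) K) :=
    fun C => ClassGroup.induction K (fun I => ⟨I, rfl⟩) C
  refine ⟨fun C => {x | x ∈ (Function.surjInv hsurj C).val},
    fun C => h.isPrimitiveLattice_fractionalIdeal hdeg hℓ _, fun M hM => ?_,
    fun C C' c hc hCC => ?_⟩
  · obtain ⟨I, rfl⟩ := hM.exists_fractionalIdeal h hℓ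
    exact ⟨ClassGroup.mk K I, (classGroup_mk_eq_mk_iff _ _).1 (Function.surjInv_eq hsurj _).symm⟩
  · rw [← Function.surjInv_eq hsurj C, ← Function.surjInv_eq hsurj C']
    exact (classGroup_mk_eq_mk_iff _ _).2 ⟨c, hc, hCC⟩

theorem IsQuadGen.finite_classGroup (hdeg : Module.finrank ℚ K = 2) (h : IsQuadGen ω t n)
    (hℓ : 0 < ℓ) : Finite (ClassGroup (orderSubring K ℓ)) := by
  obtain ⟨Λ, hΛ, -, hinj⟩ := h.exists_latticeRep hdeg hℓ
  obtain ⟨B, hB⟩ := IsPrimitiveLattice.exists_bounded h hℓ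
  choose c A r hc hA hr hb using fun C => hB (Λ C) (hΛ C)
  refine Finite.of_injective (β := Set.Icc (-B) B × Set.Icc (-B) B)
    (fun C => (⟨A C, abs_le.1 (hA C)⟩, ⟨r C, abs_le.1 (hr C)⟩)) fun C C' hCC => ?_
  have hAA : A C = A C' := congrArg (fun x => (x.1 : ℤ)) hCC
  have hrr : r C = r C' := congrArg (fun x => (x.2 : ℤ)) hCC
  refine hinj C C' (c C' / c C) (div_ne_zero (hc C') (hc C)) fun z => ?_
  have hcC := hc C
  rw [(hb C').mem_iff, ← hAA, ← hrr]
  constructor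
  · rintro ⟨p, q, rfl⟩
    exact ⟨_, ((hb C).mem_iff _).2 ⟨p, q, rfl⟩, by field_simp⟩
  · rintro ⟨y, hy, rfl⟩
    obtain ⟨p, q, rfl⟩ := ((hb C).mem_iff _).1 hy
    exact ⟨p, q, by field_simp⟩

end ClassGroup

section Count

/-- The index set for the orbits: a conductor `ℓ ∣ f`, a class of the order of conductor `ℓ` and
a unit modulo `f / ℓ` up to sign. -/
abbrev OrbitIndex (K : Type) [Field K] [NumberField K] (f : ℕ) : Type :=
  Σ ℓ : f.divisors, ClassGroup (orderSubring K ℓ) ×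
    ((ZMod (f / ℓ))ˣ ⧸ Subgroup.zpowers (-1 : (ZMod (f / ℓ))ˣ))

/-- `a, b` generate over the order of conductor `f` the lattice attached to the index `T`, with
determinant prescribed by `T`. -/
def HasOrbitIndex {f : ℕ} (Λ : ∀ ℓ : f.divisors, ClassGroup (orderSubring K ℓ) → Set K)
    (a b : K) (T : OrbitIndex K f) : Prop :=
  IsGenPair f (Λ T.1 T.2.1) a b ∧
    ∃ u : (ZMod (f / T.1))ˣ, HasDetMod (f / T.1) (Λ T.1 T.2.1) a b u ∧ ↑u = T.2.2

theorem mk_units_zmod_eq_iff {g : ℕ} (u u' : (ZMod g)ˣ) :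
    (u : (ZMod g)ˣ ⧸ Subgroup.zpowers (-1 : (ZMod g)ˣ)) = u' ↔
      (u' : ZMod g) = u ∨ (u' : ZMod g) = -u := by
  rw [QuotientGroup.eq, Subgroup.mem_zpowers_iff, ← Units.val_neg, Units.val_inj, Units.val_inj]
  constructor
  · rintro ⟨k, hk⟩
    rw [eq_inv_mul_iff_mul_eq] at hk
    rcases Int.even_or_odd k with h | h
    · rw [h.neg_one_zpow, mul_one] at hk
      exact Or.inl hk.symm
    · rw [h.neg_one_zpow, mul_neg_one] at hk
      exact Or.inr hk.symm
  · rintro (rfl | rfl)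
    · exact ⟨0, by simp⟩
    · exact ⟨1, by simp⟩

variable {ω : K} {t n : ℤ} {f : ℕ}

theorem nat_card_orbitIndex (hdeg : Module.finrank ℚ K = 2) (h : IsQuadGen ω t n) :
    Nat.card (OrbitIndex K f) =
      ∑ ℓ ∈ f.divisors, Nat.card (ClassGroup (orderSubring K ℓ)) * phiU (f / ℓ) := by
  have hpos : ∀ ℓ : f.divisors, 0 < ℓ.1 ∧ 0 < f / ℓ.1 := fun ℓ =>
    ⟨Nat.pos_of_mem_divisors ℓ.2, Nat.div_pos (Nat.divisor_le ℓ.2) (Nat.pos_of_mem_divisors ℓ.2)⟩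
  have := fun ℓ : f.divisors => h.finite_classGroup hdeg (hpos ℓ).1
  have := fun ℓ : f.divisors => NeZero.of_pos (hpos ℓ).2
  rw [Nat.card_sigma, ← Finset.sum_coe_sort f.divisors]
  exact Finset.sum_congr rfl fun ℓ _ => Nat.card_prod _ _

theorem exists_hasOrbitIndex (hdeg : Module.finrank ℚ K = 2) (h : IsQuadGen ω t n) (hf : 0 < f)
    {Λ : ∀ ℓ : f.divisors, ClassGroup (orderSubring K ℓ) → Set K}
    (hΛ : ∀ (ℓ : f.divisors) M, IsPrimitiveLattice ω t n ℓ M →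
      ∃ C, ∃ c : K, c ≠ 0 ∧ ∀ z, z ∈ Λ ℓ C ↔ ∃ y ∈ M, z = c * y)
    {a b : K} (hab : ¬(a = 0 ∧ b = 0)) : ∃ (c : K) (T : OrbitIndex K f), c ≠ 0 ∧
      HasOrbitIndex Λ (c * a) (c * b) T := by
  obtain ⟨ℓ, g, M, u, rfl, hM, hgen, hdet⟩ := exists_lattice_of_pair hdeg h hf hab
  have hℓ : 0 < ℓ := Nat.pos_of_mul_pos_left hf
  have hmem : ℓ ∈ (g * ℓ).divisors := Nat.mem_divisors.2 ⟨Dvd.intro_left _ rfl, hf.ne'⟩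
  obtain ⟨C, c, hc, hC⟩ := hΛ ⟨ℓ, hmem⟩ M hM
  obtain ⟨u, rfl⟩ : ∃ v : (ZMod g)ˣ, v = u := ⟨u, rfl⟩
  have hg : g * ℓ / ℓ = g := Nat.mul_div_cancel _ hℓ
  obtain ⟨v, hv⟩ : ∃ v : (ZMod (g * ℓ / ℓ))ˣ, HasDetMod (g * ℓ / ℓ) M a b v := by
    rw [hg]
    exact ⟨u, hdet⟩
  exact ⟨c, ⟨⟨ℓ, hmem⟩, C, v⟩, hc, hgen.scale hC, v, hv.scale hc hC, rfl⟩

theorem exists_of_orbitIndex (h : IsQuadGen ω t n) (hf : 0 < f)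
    {Λ : ∀ ℓ : f.divisors, ClassGroup (orderSubring K ℓ) → Set K}
    (hΛ : ∀ (ℓ : f.divisors) C, IsPrimitiveLattice ω t n ℓ (Λ ℓ C)) (T : OrbitIndex K f) :
    ∃ a b : K, ¬(a = 0 ∧ b = 0) ∧ HasOrbitIndex Λ a b T := by
  obtain ⟨ℓ, C, U⟩ := T
  induction U using QuotientGroup.induction_on with
  | H u =>
  have hgℓ : f / ℓ * ℓ = f := Nat.div_mul_cancel (Nat.dvd_of_mem_divisors ℓ.2)
  have hg : 0 < f / ℓ := Nat.pos_of_mul_pos_right (hgℓ.symm ▸ hf)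
  obtain ⟨a, b, hgen, hdet⟩ := (hΛ ℓ C).exists_isGenPair h hg u
  rw [hgℓ] at hgen
  refine ⟨a, b, ?_, hgen, u, hdet, rfl⟩
  rintro ⟨rfl, rfl⟩
  obtain ⟨e₁, h₁, e₂, h₂, φ₁, φ₂, hφ, -, -⟩ := (hΛ ℓ C).exists_dual h
  obtain ⟨_, -, _, -, rfl⟩ := (hgen _).1 h₁
  obtain ⟨_, -, _, -, rfl⟩ := (hgen _).1 h₂
  simp at hφ

theorem HasOrbitIndex.eq_of_transform (h : IsQuadGen ω t n)
    {Λ : ∀ ℓ : f.divisors, ClassGroup (orderSubring K ℓ) → Set K}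
    (hΛ : ∀ (ℓ : f.divisors) C, IsPrimitiveLattice ω t n ℓ (Λ ℓ C))
    (hinj : ∀ ℓ C C' (c : K), c ≠ 0 → (∀ z, z ∈ Λ ℓ C' ↔ ∃ y ∈ Λ ℓ C, z = c * y) → C = C')
    {a b a' b' : K} {T T' : OrbitIndex K f} (hT : HasOrbitIndex Λ a b T)
    (hT' : HasOrbitIndex Λ a' b' T') {c x y z w : K} (hc : c ≠ 0)
    (hx : x ∈ orderSubring K f) (hy : y ∈ orderSubring K f)
    (hz : z ∈ orderSubring K f) (hw : w ∈ orderSubring K f)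
    (hdet : x * w - y * z = 1 ∨ x * w - y * z = -1)
    (ha : a' = c * (x * a + y * b)) (hb : b' = c * (z * a + w * b)) : T = T' := by
  obtain ⟨ℓ, C, U⟩ := T
  obtain ⟨ℓ', C', U'⟩ := T'
  obtain ⟨hgen, u, hu, hU⟩ := hT
  obtain ⟨hgen', u', hu', hU'⟩ := hT'
  change (ZMod (f / ℓ))ˣ at u
  change (ZMod (f / ℓ'))ˣ at u'
  change (u : (ZMod (f / ℓ))ˣ ⧸ Subgroup.zpowers (-1 : (ZMod (f / ℓ))ˣ)) = U at hU
  change (u' : (ZMod (f / ℓ'))ˣ ⧸ Subgroup.zpowers (-1 : (ZMod (f / ℓ'))ˣ)) = U' at hU'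
  dsimp only at hgen hu hgen' hu'
  subst hU hU'
  have hgen₁ : IsGenPair f (Λ ℓ C) (x * a + y * b) (z * a + w * b) := by
    rcases hdet with hD | hD
    · exact hgen.transform hx hy hz hw (one_mem _) (by rw [hD, one_mul])
    · exact hgen.transform hx hy hz hw (neg_mem (one_mem _)) (by rw [hD]; norm_num)
  have hscale : ∀ s, s ∈ Λ ℓ' C' ↔ ∃ m ∈ Λ ℓ C, s = c * m := by
    refine fun s => (hgen' s).trans ⟨?_, ?_⟩
    · rintro ⟨p, hp, q, hq, rfl⟩
      exact ⟨_, (hgen₁ _).2 ⟨p, hp, q, hq, rfl⟩, by rw [ha, hb]; ring⟩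
    · rintro ⟨m, hm, rfl⟩
      obtain ⟨p, hp, q, hq, rfl⟩ := (hgen₁ _).1 hm
      exact ⟨p, hp, q, hq, by rw [ha, hb]; ring⟩
  have hmul : ∀ s, s ∈ orderSubring K ℓ ↔ s ∈ orderSubring K ℓ' := by
    intro s
    rw [(hΛ ℓ C).mem_order_iff h, (hΛ ℓ' C').mem_order_iff h]
    constructor
    · intro hs m' hm'
      obtain ⟨m, hm, rfl⟩ := (hscale _).1 hm'
      exact (hscale _).2 ⟨_, hs m hm, by ring⟩
    · intro hs m hm
      obtain ⟨m', hm', hmm⟩ := (hscale _).1 (hs _ ((hscale _).2 ⟨m, hm, rfl⟩))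
      rwa [mul_left_cancel₀ hc (show c * (s * m) = c * m' by rw [← hmm]; ring)]
  have hω : ∀ ℓ : ℕ, (ℓ : K) * ω ∈ orderSubring K ℓ := fun ℓ =>
    (h.mem_order _ _).2 ⟨0, 1, by simp⟩
  obtain rfl : ℓ = ℓ' := Subtype.ext <| Nat.dvd_antisymm
    (h.dvd_of_mem_order ((hmul _).2 (hω _))) (h.dvd_of_mem_order ((hmul _).1 (hω _)))
  obtain rfl := hinj ℓ C C' c hc hscale
  suffices huu : (u' : ZMod (f / ℓ)) = u ∨ (u' : ZMod (f / ℓ)) = -u by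
    rw [(mk_units_zmod_eq_iff u u').2 huu]
  have hgℓ : f = f / ℓ * ℓ := (Nat.div_mul_cancel (Nat.dvd_of_mem_divisors ℓ.2)).symm
  obtain ⟨e₁, e₂, he, p, q, r, s, rfl, rfl, hpq⟩ := hu
  obtain ⟨N, p', q', r', s', m, hm, h1, h2, hN, hN'⟩ :=
    (hΛ ℓ C).exists_det_transform h he p q r s (hgℓ ▸ hx) (hgℓ ▸ hy) (hgℓ ▸ hz) (hgℓ ▸ hw)
  have hu₂ : HasDetMod (f / ℓ) (Λ ℓ C) a' b' ((p' * s' - q' * r' : ℤ) : ZMod (f / ℓ)) := by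
    refine ⟨_, _, he.scale hc hscale, p', q', r', s', ?_, ?_, rfl⟩
    · rw [ha, h1]
      ring
    · rw [hb, h2]
      ring
  rw [hN', hpq] at hu₂
  have hsub : ∀ ε : ℤ, x * w - y * z = ε → (N : ZMod (f / ℓ)) = ε := fun ε hε => by
    rw [← sub_eq_zero, ← Int.cast_sub]
    refine h.intCast_zmod_eq_zero (neg_mem hm) ?_
    push_cast
    linear_combination hε - hN
  have hNε : (N : ZMod (f / ℓ)) = 1 ∨ (N : ZMod (f / ℓ)) = -1 := by
    rcases hdet with hD | hD
    · exact Or.inl (by simpa using hsub 1 (by simpa using hD))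
    · exact Or.inr (by simpa using hsub (-1) (by simpa using hD))
  rcases hu₂.eq_or_eq_neg hu' with h3 | h3 <;> rcases hNε with h4 | h4 <;> rw [h3, h4] <;> simp

theorem HasOrbitIndex.exists_transform (h : IsQuadGen ω t n)
    {Λ : ∀ ℓ : f.divisors, ClassGroup (orderSubring K ℓ) → Set K}
    (hΛ : ∀ (ℓ : f.divisors) C, IsPrimitiveLattice ω t n ℓ (Λ ℓ C))
    {a b a' b' : K} {T : OrbitIndex K f} (hT : HasOrbitIndex Λ a b T)
    (hT' : HasOrbitIndex Λ a' b' T) : ∃ x ∈ orderSubring K f, ∃ y ∈ orderSubring K f,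
      ∃ z ∈ orderSubring K f, ∃ w ∈ orderSubring K f, (x * w - y * z = 1 ∨ x * w - y * z = -1) ∧
        a' = x * a + y * b ∧ b' = z * a + w * b := by
  obtain ⟨hgen, u, hu, hU⟩ := hT
  obtain ⟨hgen', u', hu', hU'⟩ := hT'
  have hgℓ : f = f / T.1 * T.1 := (Nat.div_mul_cancel (Nat.dvd_of_mem_divisors T.1.2)).symm
  have := (hΛ _ _).exists_transform h (hgℓ ▸ hgen) (hgℓ ▸ hgen') hu hu' u.isUnit
    ((mk_units_zmod_eq_iff u u').1 (hU.trans hU'.symm))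
  rwa [← hgℓ] at this

end Count

section Orbits

variable {f : ℕ}

theorem gl2OrderRel_mk_of_transform {K : Type} [Field K] {v v' : Fin 2 → K}
    (hv : v ≠ 0) (hv' : v' ≠ 0) {x y z w : K}
    (hx : x ∈ orderSubring K f) (hy : y ∈ orderSubring K f)
    (hz : z ∈ orderSubring K f) (hw : w ∈ orderSubring K f)
    (hdet : x * w - y * z = 1 ∨ x * w - y * z = -1)
    (h0 : v' 0 = x * v 0 + y * v 1) (h1 : v' 1 = z * v 0 + w * v 1) :
    gl2OrderRel K f (Projectivization.mk K v hv) (Projectivization.mk K v' hv') := by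
  let γ : Matrix (Fin 2) (Fin 2) (orderSubring K f) := !![⟨x, hx⟩, ⟨y, hy⟩; ⟨z, hz⟩, ⟨w, hw⟩]
  have hγ : (γ.map (orderSubring K f).subtype).mulVec v = v' := by
    ext i
    fin_cases i
    · simp [γ, Matrix.mulVec, dotProduct, Fin.sum_univ_two, h0]
    · simp [γ, Matrix.mulVec, dotProduct, Fin.sum_univ_two, h1]
  have hdetγ : ((γ.det : orderSubring K f) : K) = x * w - y * z := by
    simp [γ, Matrix.det_fin_two]
  refine ⟨γ, ?_, v, hv, hγ ▸ hv', rfl, by simp only [hγ]⟩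
  rcases hdet with hD | hD
  · rw [show γ.det = 1 from Subtype.ext (by rw [hdetγ, hD]; rfl)]
    exact isUnit_one
  · rw [show γ.det = -1 from Subtype.ext (by rw [hdetγ, hD]; rfl)]
    exact isUnit_one.neg

theorem isIntegral_of_mem_order {K : Type} [Field K] {x : K} (hx : x ∈ orderSubring K f) :
    IsIntegral ℤ x := by
  obtain ⟨a, y, rfl⟩ := hx
  exact (isIntegral_intCast a).add ((isIntegral_natCast f).mul y.isIntegral_coe)

theorem exists_transform_of_gl2OrderRel (hdeg : Module.finrank ℚ K = 2)
    (himag : IsEmpty (K →+* ℝ))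
    (hroots : ∀ x : K, (∃ n : ℕ, 0 < n ∧ x ^ n = 1) → x = 1 ∨ x = -1)
    {v v' : Fin 2 → K} (hv : v ≠ 0) (hv' : v' ≠ 0)
    (h : gl2OrderRel K f (Projectivization.mk K v hv) (Projectivization.mk K v' hv')) :
    ∃ c : K, c ≠ 0 ∧ ∃ x ∈ orderSubring K f, ∃ y ∈ orderSubring K f,
      ∃ z ∈ orderSubring K f, ∃ w ∈ orderSubring K f, (x * w - y * z = 1 ∨ x * w - y * z = -1) ∧
        v' 0 = c * (x * v 0 + y * v 1) ∧ v' 1 = c * (z * v 0 + w * v 1) := by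
  obtain ⟨γ, hγ, u, hu, hγu, huv, huv'⟩ := h
  obtain ⟨α, hα⟩ := (Projectivization.mk_eq_mk_iff' _ _ _ _ _).1 huv.symm
  obtain ⟨β, hβ⟩ := (Projectivization.mk_eq_mk_iff' _ _ _ _ _).1 huv'
  have hα0 : α ≠ 0 := by
    rintro rfl
    exact hu (by simpa using hα.symm)
  have hβ0 : β ≠ 0 := by
    rintro rfl
    exact hv' (by simpa using hβ.symm)
  obtain ⟨δ, hδ⟩ := hγ.exists_right_inv
  have hδ' : ((γ.det : orderSubring K f) : K) * (δ : K) = 1 := congrArg Subtype.val hδ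
  refine ⟨β * α, mul_ne_zero hβ0 hα0, _, (γ 0 0).2, _, (γ 0 1).2, _, (γ 1 0).2, _, (γ 1 1).2,
    ?_, ?_, ?_⟩
  · have := eq_one_or_neg_one_of_mul_eq_one hdeg himag hroots
      (isIntegral_of_mem_order γ.det.2) (isIntegral_of_mem_order δ.2) hδ'
    simpa [Matrix.det_fin_two] using this
  · rw [← hβ, ← hα]
    simp
    ring
  · rw [← hβ, ← hα]
    simp
    ring

end Orbits

end QuadraticOrders

/-- For `K` imaginary quadratic with only `±1` as roots of unity, the number of orbits
of `GL₂(O_f)` on `ℙ¹(K)` is `∑_{ℓ ∣ f} h_ℓ · φᵤ(f/ℓ)`. -/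
theorem gl2Order_orbit_count
    (hdeg : Module.finrank ℚ K = 2)
    (himag : IsEmpty (K →+* ℝ))
    (hroots : ∀ x : K, (∃ n : ℕ, 0 < n ∧ x ^ n = 1) → x = 1 ∨ x = -1)
    (f : ℕ) (hf : 0 < f) :
    Nat.card (Quot (gl2OrderRel K f)) =
      ∑ ℓ ∈ f.divisors, Nat.card (ClassGroup (orderSubring K ℓ)) * phiU (f / ℓ) := by
  obtain ⟨ω, t, n, h⟩ := exists_isQuadGen hdeg
  choose Λ hΛ hex hinj using fun ℓ : f.divisors =>
    h.exists_latticeRep hdeg (Nat.pos_of_mem_divisors ℓ.2)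
  have hne : ∀ v : Fin 2 → K, v ≠ 0 ↔ ¬(v 0 = 0 ∧ v 1 = 0) := fun v => by
    rw [Ne, funext_iff, Fin.forall_fin_two]
    rfl
  have hrep : ∀ P : Projectivization K (Fin 2 → K), ∃ (v : Fin 2 → K) (hv : v ≠ 0)
      (T : OrbitIndex K f), P = Projectivization.mk K v hv ∧ HasOrbitIndex Λ (v 0) (v 1) T := by
    intro P
    obtain ⟨c, T, hc, hT⟩ := exists_hasOrbitIndex hdeg h hf hex ((hne _).1 P.rep_nonzero)
    refine ⟨c • P.rep, smul_ne_zero hc P.rep_nonzero, T, ?_, hT⟩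
    rw [← P.mk_rep]
    exact (Projectivization.mk_eq_mk_iff' _ _ _ _ _).2 ⟨c⁻¹, by simp [hc]⟩
  choose v hv T hvP hT using hrep
  have hrel : ∀ P Q, gl2OrderRel K f P Q ↔ T P = T Q := fun P Q => by
    constructor
    · intro hPQ
      rw [hvP P, hvP Q] at hPQ
      obtain ⟨c, hc, x, hx, y, hy, z, hz, w, hw, hdet, h0, h1⟩ :=
        exists_transform_of_gl2OrderRel hdeg himag hroots _ _ hPQ
      exact (hT P).eq_of_transform h hΛ hinj (hT Q) hc hx hy hz hw hdet h0 h1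
    · intro hPQ
      obtain ⟨x, hx, y, hy, z, hz, w, hw, hdet, h0, h1⟩ :=
        (hT P).exists_transform h hΛ (hPQ ▸ hT Q)
      rw [hvP P, hvP Q]
      exact gl2OrderRel_mk_of_transform _ _ hx hy hz hw hdet h0 h1
  rw [← nat_card_orbitIndex hdeg h]
  refine Nat.card_eq_of_bijective (Quot.lift T fun P Q hPQ => (hrel P Q).1 hPQ) ⟨?_, ?_⟩
  · rintro ⟨P⟩ ⟨Q⟩ hPQ
    exact Quot.sound ((hrel P Q).2 hPQ)
  · intro S
    obtain ⟨a, b, hab, hS⟩ := exists_of_orbitIndex h hf hΛ S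
    have hu : (![a, b] : Fin 2 → K) ≠ 0 := (hne _).2 hab
    let P := Projectivization.mk K ![a, b] hu
    refine ⟨Quot.mk _ P, ?_⟩
    obtain ⟨c, hc⟩ := (Projectivization.mk_eq_mk_iff' K _ _ hu (hv P)).1 (hvP P)
    have hc0 : c ≠ 0 := by
      rintro rfl
      exact hu (by simpa using hc.symm)
    refine (hT P).eq_of_transform h hΛ hinj hS hc0 (one_mem _) (zero_mem _) (zero_mem _)
      (one_mem _) (by simp) ?_ ?_
    · simpa using (congrFun hc 0).symm
    · simpa using (congrFun hc 1).symm

end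
end
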